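/- arXiv:math/0301148 — 2 statements merged into one kernel-verified Lean document; each statement's English description precedes it below -/
import Mathlib

section
/- Every 1-homogeneous translation-invariant continuous valuation φ on convex compact subsets of V is Minkowski additive: φ(λA + μB) = λφ(A) + μφ(B) for all convex compact A, B and all λ, μ ≥ 0. -/
open Pointwise

namespace MinkAdd

open Filter Topology

section General

variable {V : Type*} [NormedAddCommGroup V] [NormedSpace ℝ V]

/-- The support function. -/
noncomputable def supp (f : V →L[ℝ] ℝ) (K : ConvexBody V) : ℝ := sSup (f '' (K : Set V))

lemma bdd (f : V →L[ℝ] ℝ) (K : ConvexBody V) : BddAbove (f '' (K : Set V)) :=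
  (K.isCompact.image f.continuous).bddAbove

lemma supp_le_iff (f : V →L[ℝ] ℝ) (K : ConvexBody V) (c : ℝ) :
    supp f K ≤ c ↔ ∀ x ∈ (K : Set V), f x ≤ c := by
  unfold supp
  rw [csSup_le_iff (bdd f K) (K.nonempty.image f)]
  simp

lemma supp_add (f : V →L[ℝ] ℝ) (K L : ConvexBody V) :
    supp f (K + L) = supp f K + supp f L := by
  unfold supp
  rw [ConvexBody.coe_add, Set.image_add, csSup_add (K.nonempty.image f) (bdd f K)
    (L.nonempty.image f) (bdd f L)]

lemma supp_zero (f : V →L[ℝ] ℝ) : supp f (0 : ConvexBody V) = 0 := by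
  unfold supp
  rw [ConvexBody.coe_zero]
  rw [← Set.singleton_zero]
  simp

lemma supp_sum {ι : Type*} (f : V →L[ℝ] ℝ) (s : Finset ι) (K : ι → ConvexBody V) :
    supp f (∑ i ∈ s, K i) = ∑ i ∈ s, supp f (K i) :=
  map_sum (⟨⟨supp f, supp_zero f⟩, supp_add f⟩ : ConvexBody V →+ ℝ) K s

lemma le_of_supp {K L : ConvexBody V} (h : ∀ f, supp f K ≤ supp f L) :
    (K : Set V) ⊆ L := by
  intro x hx
  by_contra hxL
  obtain ⟨f, u, h1, h2⟩ := geometric_hahn_banach_closed_point L.convex L.isClosed hxL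
  have a := (supp_le_iff f L u).2 fun y hy => (h1 y hy).le
  have b := (supp_le_iff f K _).1 (h f) x hx
  linarith

lemma eq_of_supp {K L : ConvexBody V} (h : ∀ f, supp f K = supp f L) : K = L :=
  ConvexBody.ext (Set.Subset.antisymm (le_of_supp fun f => (h f).le)
    (le_of_supp fun f => (h f).ge))

open Classical in
/-- Convex hull of a nonempty finite set as a convex body. -/
noncomputable def hull (s : Finset V) : ConvexBody V :=
  if h : s.Nonempty then
    ⟨convexHull ℝ (s : Set V), convex_convexHull ℝ _, s.finite_toSet.isCompact_convexHull ℝ,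
      h.to_set.convexHull⟩
  else 0

lemma coe_hull {s : Finset V} (h : s.Nonempty) :
    (hull s : Set V) = convexHull ℝ (s : Set V) := by
  unfold hull
  rw [dif_pos h]
  rfl

lemma supp_hull_le_iff (f : V →L[ℝ] ℝ) {s : Finset V} (h : s.Nonempty) (c : ℝ) :
    supp f (hull s) ≤ c ↔ ∀ x ∈ s, f x ≤ c := by
  rw [supp_le_iff, coe_hull h]
  constructor
  · intro H x hx
    exact H x (subset_convexHull ℝ _ hx)
  · intro H x hx
    have : convexHull ℝ (s : Set V) ⊆ {w | f w ≤ c} :=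
      convexHull_min (fun y hy => H y hy) (convex_halfSpace_le f.toLinearMap.isLinear c)
    exact this hx

lemma supp_hull_insert [DecidableEq V] (f : V →L[ℝ] ℝ) {s : Finset V} {i j : V} (hj : j ∈ s)
    (hij : f i ≤ f j) : supp f (hull (insert i s)) = supp f (hull s) := by
  refine eq_of_forall_ge_iff fun c => ?_
  rw [supp_hull_le_iff f (Finset.insert_nonempty _ _), supp_hull_le_iff f ⟨j, hj⟩]
  simp only [Finset.mem_insert, forall_eq_or_imp]
  exact ⟨fun h => h.2, fun h => ⟨hij.trans (h j hj), h⟩⟩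

lemma exists_le_of_hull (f : V →L[ℝ] ℝ) {s : Set V} {p : V} (hp : p ∈ convexHull ℝ s) :
    ∃ i ∈ s, f i ≤ f p := by
  by_contra! H
  have : convexHull ℝ s ⊆ {w | f p < f w} :=
    convexHull_min (fun y hy => H y hy) (convex_halfSpace_gt f.toLinearMap.isLinear _)
  exact lt_irrefl (f p) (this hp)

lemma exists_ge_of_hull (f : V →L[ℝ] ℝ) {s : Set V} {p : V} (hp : p ∈ convexHull ℝ s) :
    ∃ i ∈ s, f p ≤ f i := by
  by_contra! H
  have : convexHull ℝ s ⊆ {w | f w < f p} :=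
    convexHull_min (fun y hy => H y hy) (convex_halfSpace_lt f.toLinearMap.isLinear _)
  exact lt_irrefl (f p) (this hp)

/-- The Radon relation between support functions. -/
lemma radon_supp [DecidableEq V] (f : V →L[ℝ] ℝ) {I J : Finset V} {p : V}
    (hI : p ∈ convexHull ℝ (I : Set V)) (hJ : p ∈ convexHull ℝ (J : Set V)) :
    ∑ S ∈ I.powerset, (-1 : ℝ) ^ (I.card + S.card) * supp f (hull (S ∪ J)) = 0 := by
  obtain ⟨i, hi, hip⟩ := exists_le_of_hull f hI
  obtain ⟨j, hj, hjp⟩ := exists_ge_of_hull f hJ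
  have hi' : i ∈ I := hi
  have hj' : j ∈ J := hj
  generalize I.card = k
  rw [← Finset.insert_erase hi', Finset.sum_powerset_insert (Finset.notMem_erase _ _),
    ← Finset.sum_add_distrib]
  refine Finset.sum_eq_zero fun S hS => ?_
  have hiS : i ∉ S := fun h => Finset.notMem_erase i I (Finset.mem_powerset.1 hS h)
  rw [Finset.insert_union, supp_hull_insert f (Finset.mem_union_right S hj') (hip.trans hjp),
    Finset.card_insert_of_notMem hiS]
  ring

/-- The Radon relation between convex bodies. -/
lemma radon_body [DecidableEq V] {I J : Finset V} {p : V}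
    (hI : p ∈ convexHull ℝ (I : Set V)) (hJ : p ∈ convexHull ℝ (J : Set V)) :
    hull (I ∪ J) + ∑ S ∈ I.ssubsets with Even (I.card + S.card), hull (S ∪ J) =
      ∑ S ∈ I.ssubsets with ¬ Even (I.card + S.card), hull (S ∪ J) := by
  refine eq_of_supp fun f => ?_
  rw [supp_add, supp_sum, supp_sum]
  have h := radon_supp f hI hJ
  rw [← Finset.add_sum_erase _ _ (Finset.mem_powerset_self I)] at h
  change _ + ∑ S ∈ I.ssubsets, _ = _ at h
  rw [← Finset.sum_filter_add_sum_filter_not I.ssubsets (fun S => Even (I.card + S.card))] at h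
  rw [Finset.sum_congr rfl (g := fun S => supp f (hull (S ∪ J))) (s₁ := Finset.filter (fun S => Even (I.card + S.card)) I.ssubsets)
    (fun S hS => by rw [(Finset.mem_filter.1 hS).2.neg_one_pow, one_mul]),
    Finset.sum_congr rfl (g := fun S => - supp f (hull (S ∪ J))) (s₁ := Finset.filter (fun S => ¬ Even (I.card + S.card)) I.ssubsets)
    (fun S hS => by rw [(Nat.not_even_iff_odd.1 (Finset.mem_filter.1 hS).2).neg_one_pow, neg_one_mul]),
    (Even.add_self I.card).neg_one_pow, Finset.sum_neg_distrib] at h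
  linarith

lemma dist_add_left_le (A B C : ConvexBody V) : dist (A + B) (A + C) ≤ dist B C := by
  refine le_of_forall_pos_lt_add fun ε hε => ?_
  have hlt : Metric.hausdorffDist (B : Set V) C < dist B C + ε / 2 := by
    rw [ConvexBody.hausdorffDist_coe]; linarith
  have hle : dist (A + B) (A + C) ≤ dist B C + ε / 2 := by
    rw [← ConvexBody.hausdorffDist_coe (A + B)]
    refine Metric.hausdorffDist_le_of_mem_dist (by positivity) ?_ ?_
    · rintro _ ⟨a, ha, b, hb, rfl⟩
      obtain ⟨c, hc, hd⟩ := Metric.exists_dist_lt_of_hausdorffDist_lt hb hlt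
        ConvexBody.hausdorffEDist_ne_top
      exact ⟨a + c, ⟨a, ha, c, hc, rfl⟩, by simpa using hd.le⟩
    · rintro _ ⟨a, ha, b, hb, rfl⟩
      obtain ⟨c, hc, hd⟩ := Metric.exists_dist_lt_of_hausdorffDist_lt' hb hlt
        ConvexBody.hausdorffEDist_ne_top
      exact ⟨a + c, ⟨a, ha, c, hc, rfl⟩, by simpa [dist_comm] using hd.le⟩
  linarith

lemma continuous_add_left (A : ConvexBody V) : Continuous fun B => A + B :=
  (LipschitzWith.of_dist_le_mul (K := 1) fun B C => by simpa using dist_add_left_le A B C).continuous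

lemma tendsto_smul_zero (A : ConvexBody V) :
    Tendsto (fun m : ℕ => ((m : ℝ) + 1)⁻¹ • A) atTop (𝓝 0) := by
  obtain ⟨C, hC, hb⟩ := A.isBounded.exists_pos_norm_le
  rw [tendsto_iff_dist_tendsto_zero]
  have h0 : Tendsto (fun m : ℕ => ((m : ℝ) + 1)⁻¹ * C) atTop (𝓝 0) := by
    have := (tendsto_one_div_add_atTop_nhds_zero_nat (𝕜 := ℝ)).mul_const C
    simpa using this
  refine squeeze_zero (fun _ => dist_nonneg) (fun m => ?_) h0
  have hm : 0 ≤ ((m : ℝ) + 1)⁻¹ := by positivity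
  have key : ∀ a ∈ (A : Set V), ‖((m : ℝ) + 1)⁻¹ • a‖ ≤ ((m : ℝ) + 1)⁻¹ * C := by
    intro a ha
    rw [norm_smul, Real.norm_of_nonneg hm]
    exact mul_le_mul_of_nonneg_left (hb a ha) hm
  rw [← ConvexBody.hausdorffDist_coe]
  refine Metric.hausdorffDist_le_of_mem_dist (by positivity) ?_ ?_
  · rintro _ ⟨a, ha, rfl⟩
    exact ⟨0, by simp, by simpa using key a ha⟩
  · intro x hx
    have hx0 : x = 0 := by simpa using hx
    obtain ⟨a, ha⟩ := A.nonempty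
    refine ⟨((m : ℝ) + 1)⁻¹ • a, ⟨a, ha, rfl⟩, ?_⟩
    rw [hx0, dist_zero_left]
    exact key a ha

/-- Polytopes are dense. -/
lemma exists_hull (B : ConvexBody V) {ε : ℝ} (hε : 0 < ε) :
    ∃ s : Finset V, s.Nonempty ∧ dist (hull s) B ≤ ε := by
  obtain ⟨t, htB, htf, hcov⟩ := B.isCompact.finite_cover_balls hε
  have hne : htf.toFinset.Nonempty := by
    obtain ⟨b, hb⟩ := B.nonempty
    obtain ⟨x, hx, -⟩ := Set.mem_iUnion₂.1 (hcov hb)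
    exact ⟨x, by simpa using hx⟩
  refine ⟨htf.toFinset, hne, ?_⟩
  rw [← ConvexBody.hausdorffDist_coe, coe_hull hne, htf.coe_toFinset]
  refine Metric.hausdorffDist_le_of_mem_dist hε.le ?_ ?_
  · intro x hx
    exact ⟨x, convexHull_min htB B.convex hx, by simpa using hε.le⟩
  · intro b hb
    obtain ⟨x, hx, hd⟩ := Set.mem_iUnion₂.1 (hcov hb)
    exact ⟨x, subset_convexHull ℝ _ hx, (Metric.mem_ball.1 hd).le⟩

/-- If `K ∪ L` is convex then `(K ∩ L) + A = (K + A) ∩ (L + A)`. -/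
lemma add_inter {A K L KL KI : ConvexBody V} (hU : (KL : Set V) = ↑K ∪ ↑L)
    (hI : (KI : Set V) = ↑K ∩ ↑L) :
    ((A + KI : ConvexBody V) : Set V) = ↑(A + K) ∩ ↑(A + L) := by
  simp only [ConvexBody.coe_add]
  ext x
  constructor
  · rintro ⟨a, ha, b, hb, rfl⟩
    rw [hI] at hb
    exact ⟨⟨a, ha, b, hb.1, rfl⟩, ⟨a, ha, b, hb.2, rfl⟩⟩
  · rintro ⟨⟨a, ha, k, hk, rfl⟩, ⟨a', ha', l, hl, hx⟩⟩
    have hx' : a' + l = a + k := hx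
    have hpre : IsPreconnected (segment ℝ k l) := (convex_segment k l).isPreconnected
    have hsub : segment ℝ k l ⊆ ↑K ∪ ↑L := by
      rw [← hU]
      exact KL.convex.segment_subset (by rw [hU]; exact Or.inl hk) (by rw [hU]; exact Or.inr hl)
    obtain ⟨m, hm, hmK, hmL⟩ := isPreconnected_closed_iff.1 hpre K L K.isClosed L.isClosed hsub
      ⟨k, left_mem_segment ℝ k l, hk⟩ ⟨l, right_mem_segment ℝ k l, hl⟩
    obtain ⟨s, t, hs, ht, hst, rfl⟩ := hm
    refine ⟨s • a + t • a', A.convex ha ha' hs ht hst, s • k + t • l, by rw [hI]; exact ⟨hmK, hmL⟩, ?_⟩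
    change s • a + t • a' + (s • k + t • l) = a + k
    have : s • a + t • a' + (s • k + t • l) = s • (a + k) + t • (a' + l) := by module
    rw [this, hx', ← add_smul, hst, one_smul]

variable (φ : ConvexBody V → ℝ)

/-- The bodies that `φ` is additive against. -/
def IsAdd (B : ConvexBody V) : Prop := ∀ A, φ (A + B) = φ A + φ B

variable {φ}

lemma IsAdd.add {B C : ConvexBody V} (hB : IsAdd φ B) (hC : IsAdd φ C) : IsAdd φ (B + C) := by
  intro A
  rw [← add_assoc, hC, hB, hC B]
  ring

lemma isAdd_sum {ι : Type*} (h0 : IsAdd φ 0) (s : Finset ι) (K : ι → ConvexBody V)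
    (h : ∀ i ∈ s, IsAdd φ (K i)) : IsAdd φ (∑ i ∈ s, K i) :=
  Finset.sum_induction K (IsAdd φ) (fun _ _ => IsAdd.add) h0 h

lemma IsAdd.cancel {B X Y : ConvexBody V} (hX : IsAdd φ X) (hY : IsAdd φ Y) (h : B + X = Y) :
    IsAdd φ B := by
  intro A
  have h1 := hX (A + B)
  rw [add_assoc, h, hY] at h1
  have h2 := hX B
  rw [h] at h2
  linarith

variable (hval : ∀ K L KL KI : ConvexBody V,
      (KL : Set V) = ↑K ∪ ↑L → (KI : Set V) = ↑K ∩ ↑L → φ KL = φ K + φ L - φ KI)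
    (htrans : ∀ (K K' : ConvexBody V) (x : V), (K' : Set V) = (fun v => v + x) '' ↑K → φ K' = φ K)
    (hcont : Continuous φ)
    (hhom : ∀ (lam : ℝ), 0 ≤ lam → ∀ K, φ (lam • K) = lam * φ K)

/-- A point as a convex body. -/
def pt (x : V) : ConvexBody V :=
  ⟨{x}, convex_singleton x, isCompact_singleton, Set.singleton_nonempty x⟩

lemma coe_pt (x : V) : (pt x : Set V) = {x} := rfl

include hhom in
lemma phi_zero : φ 0 = 0 := by
  have := hhom 0 le_rfl 0
  simpa using this

include hhom htrans in
lemma isAdd_pt (x : V) : IsAdd φ (pt x) := by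
  have h0 : φ (pt x) = 0 := by
    rw [← phi_zero hhom]
    refine htrans 0 _ x ?_
    rw [coe_pt, ConvexBody.coe_zero, ← Set.singleton_zero]
    simp
  intro A
  rw [h0, add_zero]
  refine htrans A _ x ?_
  rw [ConvexBody.coe_add, coe_pt, Set.add_singleton]

include hhom in
lemma isAdd_smul {B : ConvexBody V} (hB : IsAdd φ B) {c : ℝ} (hc : 0 < c) : IsAdd φ (c • B) := by
  intro A
  have : A + c • B = c • (c⁻¹ • A + B) := by
    rw [smul_add, smul_smul, mul_inv_cancel₀ hc.ne', one_smul]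
  rw [this, hhom c hc.le, hB, hhom _ (inv_pos.2 hc).le, hhom c hc.le]
  field_simp

include hval in
lemma hval_add (A K L KL KI : ConvexBody V)
    (hU : (KL : Set V) = ↑K ∪ ↑L) (hI : (KI : Set V) = ↑K ∩ ↑L) :
    φ (A + KL) = φ (A + K) + φ (A + L) - φ (A + KI) := by
  refine hval _ _ _ _ ?_ (add_inter hU hI)
  simp only [ConvexBody.coe_add]
  rw [hU, Set.add_union]

include hval hcont hhom in
/-- Cones over a body contained in a hyperplane away from the apex. -/
lemma isAdd_cone {F T : ConvexBody V} (hF : IsAdd φ F) (f : V →ₗ[ℝ] ℝ)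
    (hf : ∀ y ∈ (F : Set V), f y = 1)
    (hT : ∀ x, x ∈ (T : Set V) ↔ ∃ t : ℝ, 0 ≤ t ∧ t ≤ 1 ∧ ∃ y ∈ (F : Set V), x = t • y) :
    IsAdd φ T := by
  -- membership in dilates
  have hmT : ∀ (c : ℝ), 0 < c → ∀ x, x ∈ ((c • T : ConvexBody V) : Set V) ↔
      ∃ t : ℝ, 0 ≤ t ∧ t ≤ c ∧ ∃ y ∈ (F : Set V), x = t • y := by
    intro c hc x
    rw [ConvexBody.coe_smul]
    constructor
    · rintro ⟨z, hz, rfl⟩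
      obtain ⟨t, h0, h1, y, hy, rfl⟩ := (hT z).1 hz
      exact ⟨c * t, by positivity, by nlinarith, y, hy, by simp [smul_smul]⟩
    · rintro ⟨t, h0, h1, y, hy, rfl⟩
      refine ⟨(t / c) • y, (hT _).2 ⟨t / c, by positivity, (div_le_one hc).2 h1, y, hy, rfl⟩, ?_⟩
      change c • (t / c) • y = t • y
      rw [smul_smul, mul_div_cancel₀ _ hc.ne']
  have step : ∀ (A : ConvexBody V) (c : ℝ), 0 < c →
      φ (A + (c + 1) • T) = φ (A + c • T) + φ (A + T) - φ A := by
    intro A c hc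
    have hcF := isAdd_smul hhom hF hc
    have hFT : ∀ x, x ∈ ((T + c • F : ConvexBody V) : Set V) ↔
        ∃ t : ℝ, c ≤ t ∧ t ≤ c + 1 ∧ ∃ y ∈ (F : Set V), x = t • y := by
      intro x
      rw [ConvexBody.coe_add, ConvexBody.coe_smul]
      constructor
      · rintro ⟨z, hz, _, ⟨y, hy, rfl⟩, rfl⟩
        obtain ⟨t, h0, h1, y', hy', rfl⟩ := (hT z).1 hz
        have hpos : 0 < c + t := by linarith
        refine ⟨c + t, by linarith, by linarith, (t / (c + t)) • y' + (c / (c + t)) • y,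
          F.convex hy' hy (by positivity) (by positivity) (by field_simp; ring), ?_⟩
        change t • y' + c • y = _
        rw [smul_add, smul_smul, smul_smul, mul_div_cancel₀ _ hpos.ne', mul_div_cancel₀ _ hpos.ne']
      · rintro ⟨t, h0, h1, y, hy, rfl⟩
        refine ⟨(t - c) • y, (hT _).2 ⟨t - c, by linarith, by linarith, y, hy, rfl⟩, c • y,
          ⟨y, hy, rfl⟩, ?_⟩
        change (t - c) • y + c • y = t • y
        module
    have key := hval_add hval A (c • T) (T + c • F) ((c + 1) • T) (c • F) ?_ ?_
    · rw [key, hcF, ← add_assoc, hcF]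
      ring
    · ext x
      rw [Set.mem_union, hmT _ hc, hmT _ (by linarith), hFT]
      constructor
      · rintro ⟨t, h0, h1, y, hy, rfl⟩
        rcases le_total t c with h | h
        · exact Or.inl ⟨t, h0, h, y, hy, rfl⟩
        · exact Or.inr ⟨t, h, h1, y, hy, rfl⟩
      · rintro (⟨t, h0, h1, y, hy, rfl⟩ | ⟨t, h0, h1, y, hy, rfl⟩)
        · exact ⟨t, h0, by linarith, y, hy, rfl⟩
        · exact ⟨t, by linarith, h1, y, hy, rfl⟩
    · ext x
      rw [Set.mem_inter_iff, hmT _ hc, hFT, ConvexBody.coe_smul]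
      constructor
      · rintro ⟨y, hy, rfl⟩
        exact ⟨⟨c, hc.le, le_rfl, y, hy, rfl⟩, ⟨c, le_rfl, by linarith, y, hy, rfl⟩⟩
      · rintro ⟨⟨t, h0, h1, y, hy, rfl⟩, ⟨t', h0', h1', y', hy', hx⟩⟩
        have := congrArg f hx
        rw [map_smul, map_smul, hf y hy, hf y' hy', smul_eq_mul, smul_eq_mul, mul_one, mul_one]
          at this
        have ht : t = c := by linarith
        exact ⟨y, hy, by rw [ht]⟩
  intro A
  have lin : ∀ m : ℕ, φ (A + ((m : ℝ) + 1) • T) = φ A + ((m : ℝ) + 1) * (φ (A + T) - φ A) := by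
    intro m
    induction m with
    | zero => simp
    | succ m ih =>
      push_cast
      rw [step A ((m : ℝ) + 1) (by positivity), ih]
      ring
  have lin2 : ∀ m : ℕ, φ (T + ((m : ℝ) + 1)⁻¹ • A) =
      ((m : ℝ) + 1)⁻¹ * φ A + (φ (A + T) - φ A) := by
    intro m
    have hm : (0 : ℝ) < (m : ℝ) + 1 := by positivity
    have : T + ((m : ℝ) + 1)⁻¹ • A = ((m : ℝ) + 1)⁻¹ • (A + ((m : ℝ) + 1) • T) := by
      rw [smul_add, smul_smul, inv_mul_cancel₀ hm.ne', one_smul, add_comm]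
    rw [this, hhom _ (inv_pos.2 hm).le, lin]
    field_simp
  have l1 : Tendsto (fun m : ℕ => φ (T + ((m : ℝ) + 1)⁻¹ • A)) atTop (𝓝 (φ T)) := by
    have := ((hcont.comp (continuous_add_left T)).tendsto 0).comp (tendsto_smul_zero A)
    simpa [Function.comp_def] using this
  have l2 : Tendsto (fun m : ℕ => φ (T + ((m : ℝ) + 1)⁻¹ • A)) atTop (𝓝 (φ (A + T) - φ A)) := by
    simp_rw [lin2]
    have := ((tendsto_one_div_add_atTop_nhds_zero_nat (𝕜 := ℝ)).mul_const (φ A)).add_const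
      (φ (A + T) - φ A)
    simpa using this
  have := tendsto_nhds_unique l1 l2
  linarith

include htrans hhom in
lemma isAdd_trans {B : ConvexBody V} {x : V} (h : IsAdd φ (B + pt x)) : IsAdd φ B :=
  IsAdd.cancel (isAdd_pt htrans hhom x) h rfl

include hval htrans hcont hhom in
lemma isAdd_hull (s : Finset V) (hs : s.Nonempty) : IsAdd φ (hull s) := by
  classical
  induction hn : s.card using Nat.strong_induction_on generalizing s with
  | _ n ih =>
  subst hn
  by_cases hind : AffineIndependent ℝ (fun x : (s : Set V) => (x : V))
  · obtain ⟨v, hv⟩ := hs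
    rcases (s.erase v).eq_empty_or_nonempty with he | hne
    · have hsv : s = {v} := by
        rw [← Finset.insert_erase hv, he]; rfl
      have : hull s = pt v := by
        apply ConvexBody.ext
        rw [coe_hull ⟨v, hv⟩, hsv, coe_pt]
        simp
      rw [this]
      exact isAdd_pt htrans hhom v
    · have hF := ih _ (Finset.card_erase_lt_of_mem hv) (s.erase v) hne rfl
      have hF' := hF.add (isAdd_pt htrans hhom (-v))
      refine isAdd_trans htrans hhom (x := -v) ?_
      rw [affineIndependent_set_iff_linearIndependent_vsub ℝ (show v ∈ (s : Set V) from hv)] at hind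
      replace hind : LinearIndepOn ℝ id _ := hind
      let b := Module.Basis.extend hind
      let f : V →ₗ[ℝ] ℝ := b.constr ℝ (fun _ => (1 : ℝ))
      have hf1 : ∀ y ∈ s.erase v, f (y - v) = 1 := by
        intro y hy
        have hy' := Finset.mem_erase.1 hy
        have hmem : y - v ∈ hind.extend (Set.subset_univ _) :=
          hind.subset_extend _ ⟨y, ⟨hy'.2, hy'.1⟩, rfl⟩
        have e : b ⟨y - v, hmem⟩ = y - v := Module.Basis.extend_apply_self hind _
        rw [← e]
        exact b.constr_basis ℝ _ _
      have hcoe : ((hull (s.erase v) + pt (-v) : ConvexBody V) : Set V) =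
          (fun y => y + -v) '' convexHull ℝ ((s.erase v : Finset V) : Set V) := by
        rw [ConvexBody.coe_add, coe_pt, Set.add_singleton, coe_hull hne]
      refine isAdd_cone hval hcont hhom hF' f ?_ ?_
      · rw [hcoe]
        rintro _ ⟨y, hy, rfl⟩
        have hsub : convexHull ℝ ((s.erase v : Finset V) : Set V) ⊆ {w | f w = 1 + f v} := by
          refine convexHull_min (fun z hz => ?_) (convex_hyperplane f.isLinear _)
          have := hf1 z hz
          rw [map_sub] at this
          change f z = 1 + f v
          linarith
        have : f y = 1 + f v := hsub hy
        simp only [map_add, map_neg]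
        linarith
      · intro x
        rw [hcoe, ConvexBody.coe_add, coe_pt, Set.add_singleton, coe_hull ⟨v, hv⟩]
        have hins : (s : Set V) = insert v ((s.erase v : Finset V) : Set V) := by
          rw [← Finset.coe_insert, Finset.insert_erase hv]
        rw [hins, convexHull_insert hne.to_set]
        constructor
        · rintro ⟨z, hz, rfl⟩
          rw [mem_convexJoin] at hz
          obtain ⟨v', hv', y, hy, a, t, ha, ht, hat, rfl⟩ := hz
          rw [Set.mem_singleton_iff] at hv'
          subst hv'
          refine ⟨t, ht, by linarith, _, ⟨y, hy, rfl⟩, ?_⟩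
          have : a = 1 - t := by linarith
          subst this
          module
        · rintro ⟨t, h0, h1, _, ⟨y, hy, rfl⟩, rfl⟩
          refine ⟨(1 - t) • v + t • y, ?_, by module⟩
          rw [mem_convexJoin]
          exact ⟨v, rfl, y, hy, 1 - t, t, by linarith, h0, by ring, rfl⟩
  · obtain ⟨I, p, hpI, hpJ⟩ := Convex.radon_partition hind
    let I' : Finset V := s.filter fun x => x ∈ Subtype.val '' I
    let J' : Finset V := s.filter fun x => x ∈ Subtype.val '' Iᶜ
    have hI' : (I' : Set V) = (fun x : (s : Set V) => (x : V)) '' I := by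
      ext x
      simp only [I', Finset.coe_filter, Set.mem_ofPred_eq, and_iff_right_iff_imp]
      rintro ⟨y, -, rfl⟩
      exact y.2
    have hJ' : (J' : Set V) = (fun x : (s : Set V) => (x : V)) '' Iᶜ := by
      ext x
      simp only [J', Finset.coe_filter, Set.mem_ofPred_eq, and_iff_right_iff_imp]
      rintro ⟨y, -, rfl⟩
      exact y.2
    rw [← hI'] at hpI
    rw [← hJ'] at hpJ
    have hIJ : I' ∪ J' = s := by
      apply Finset.coe_injective
      rw [Finset.coe_union, hI', hJ', ← Set.image_union, Set.union_compl_self]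
      simp
    have hdisj : Disjoint I' J' := by
      rw [← Finset.disjoint_coe, hI', hJ']
      exact (Set.disjoint_image_iff Subtype.val_injective).2 disjoint_compl_right
    have hJne : J'.Nonempty := by
      have : (J' : Set V).Nonempty := convexHull_nonempty_iff.1 ⟨p, hpJ⟩
      exact this
    have hall : ∀ S ∈ I'.ssubsets, IsAdd φ (hull (S ∪ J')) := by
      intro S hS
      rw [Finset.mem_ssubsets] at hS
      refine ih _ ?_ _ (hJne.mono Finset.subset_union_right) rfl
      calc (S ∪ J').card ≤ S.card + J'.card := Finset.card_union_le _ _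
        _ < I'.card + J'.card := by
          have := Finset.card_lt_card hS
          omega
        _ = s.card := by rw [← Finset.card_union_of_disjoint hdisj, hIJ]
    have h0 : IsAdd φ 0 := isAdd_pt htrans hhom 0
    have hrad := radon_body hpI hpJ
    rw [hIJ] at hrad
    exact IsAdd.cancel (isAdd_sum h0 _ _ fun S hS => hall S (Finset.mem_filter.1 hS).1)
      (isAdd_sum h0 _ _ fun S hS => hall S (Finset.mem_filter.1 hS).1) hrad

include hval htrans hcont hhom in
lemma isAdd_all (B : ConvexBody V) : IsAdd φ B := by
  intro A
  have hclosed : IsClosed {B : ConvexBody V | φ (A + B) = φ A + φ B} :=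
    isClosed_eq (hcont.comp (continuous_add_left A)) (continuous_const.add hcont)
  have : B ∈ closure {B : ConvexBody V | φ (A + B) = φ A + φ B} := by
    rw [Metric.mem_closure_iff]
    intro ε hε
    obtain ⟨s, hs, hd⟩ := exists_hull B (half_pos hε)
    refine ⟨hull s, isAdd_hull hval htrans hcont hhom s hs A, ?_⟩
    rw [dist_comm]
    linarith
  rwa [hclosed.closure_eq] at this

end General

end MinkAdd

/-- every `1`-homogeneous translation invariant continuous valuation `φ`
on convex compact subsets of a Euclidean space is Minkowski additive:
`φ(λA + μB) = λφ(A) + μφ(B)` for all convex bodies `A, B` and `λ, μ ≥ 0`. -/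
theorem one_homogeneous_valuation_minkowski_additive (n : ℕ)
    (φ : ConvexBody (EuclideanSpace ℝ (Fin n)) → ℝ)
    -- valuation property
    (hval : ∀ K L KL KI : ConvexBody (EuclideanSpace ℝ (Fin n)),
      (KL : Set (EuclideanSpace ℝ (Fin n))) = ↑K ∪ ↑L →
      (KI : Set (EuclideanSpace ℝ (Fin n))) = ↑K ∩ ↑L →
      φ KL = φ K + φ L - φ KI)
    -- translation invariance
    (htrans : ∀ (K K' : ConvexBody (EuclideanSpace ℝ (Fin n)))
      (x : EuclideanSpace ℝ (Fin n)),
      (K' : Set (EuclideanSpace ℝ (Fin n))) = (fun v => v + x) '' ↑K → φ K' = φ K)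
    -- continuity in the Hausdorff metric
    (hcont : Continuous φ)
    -- 1-homogeneity
    (hhom : ∀ (lam : ℝ), 0 ≤ lam → ∀ K, φ (lam • K) = lam * φ K) :
    ∀ (A B : ConvexBody (EuclideanSpace ℝ (Fin n))) (lam mu : ℝ),
      0 ≤ lam → 0 ≤ mu → φ (lam • A + mu • B) = lam * φ A + mu * φ B := by
  intro A B lam mu hl hm
  rw [MinkAdd.isAdd_all hval htrans hcont hhom (mu • B) (lam • A), hhom lam hl, hhom mu hm]
end

section
/- Let G be a compact subgroup of O(n) acting transitively on the unit sphere S^{n−1} of ℝ^n. Then every G-invariant translation invariant continuous (n−1)-homogeneous valuation on convex compact subsets of ℝ^n is a scalar multiple of the intrinsic volume V_{n−1}. -/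
open Pointwise MeasureTheory

namespace CodimOne

variable {n : ℕ}

lemma exists_proj (K : Set (EuclideanSpace ℝ (Fin n))) (hK : IsCompact K) (hc : Convex ℝ K)
    (hne : K.Nonempty) :
    ∃ p : EuclideanSpace ℝ (Fin n) → EuclideanSpace ℝ (Fin n), (∀ x, p x ∈ K) ∧
      ∀ x, ∀ w ∈ K, inner ℝ (x - p x) (w - p x) ≤ 0 := by
  have h : ∀ x, ∃ v ∈ K, ∀ w ∈ K, inner ℝ (x - v) (w - v) ≤ 0 := by
    intro x
    obtain ⟨v, hv, h⟩ := exists_norm_eq_iInf_of_complete_convex hne hK.isComplete hc x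
    exact ⟨v, hv, (norm_eq_iInf_iff_real_inner_le_zero hc hv).1 h⟩
  choose p h1 h2 using h
  exact ⟨p, h1, h2⟩

section proj
variable {K : Set (EuclideanSpace ℝ (Fin n))}
  {p : EuclideanSpace ℝ (Fin n) → EuclideanSpace ℝ (Fin n)}

lemma proj_firm (hp : ∀ x, p x ∈ K)
    (hi : ∀ x, ∀ w ∈ K, inner ℝ (x - p x) (w - p x) ≤ 0) (x y : EuclideanSpace ℝ (Fin n)) :
    ‖p x - p y‖ ^ 2 ≤ inner ℝ (x - y) (p x - p y) := by
  have h1 := hi x (p y) (hp y)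
  have h2 := hi y (p x) (hp x)
  rw [← real_inner_self_eq_norm_sq]
  simp only [inner_sub_left, inner_sub_right] at *
  have := real_inner_comm (p x) (p y)
  linarith

lemma proj_lip (hp : ∀ x, p x ∈ K)
    (hi : ∀ x, ∀ w ∈ K, inner ℝ (x - p x) (w - p x) ≤ 0) : LipschitzWith 1 p := by
  apply LipschitzWith.of_dist_le_mul
  intro x y
  have h := proj_firm hp hi x y
  have h2 := real_inner_le_norm (x - y) (p x - p y)
  rw [dist_eq_norm, dist_eq_norm]
  simp only [NNReal.coe_one, one_mul]
  by_contra! h3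
  nlinarith [norm_nonneg (x - y), norm_nonneg (p x - p y)]

lemma proj_unique (hp : ∀ x, p x ∈ K)
    (hi : ∀ x, ∀ w ∈ K, inner ℝ (x - p x) (w - p x) ≤ 0) {x v : EuclideanSpace ℝ (Fin n)}
    (hv : v ∈ K) (h : ∀ w ∈ K, inner ℝ (x - v) (w - v) ≤ 0) : p x = v := by
  have h1 := hi x v hv
  have h2 := h (p x) (hp x)
  have : inner ℝ (p x - v) (p x - v) ≤ 0 := by
    simp only [inner_sub_left, inner_sub_right] at *
    have := real_inner_comm (p x) v
    linarith
  rw [real_inner_self_eq_norm_sq] at this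
  have : ‖p x - v‖ = 0 := by nlinarith [norm_nonneg (p x - v)]
  rwa [norm_eq_zero, sub_eq_zero] at this

lemma proj_infDist (hp : ∀ x, p x ∈ K)
    (hi : ∀ x, ∀ w ∈ K, inner ℝ (x - p x) (w - p x) ≤ 0) (x : EuclideanSpace ℝ (Fin n)) :
    Metric.infDist x K = ‖x - p x‖ := by
  apply le_antisymm
  · rw [← dist_eq_norm]; exact Metric.infDist_le_dist_of_mem (hp x)
  · rw [Metric.le_infDist ⟨p x, hp x⟩]
    intro y hy
    have h := hi x y hy
    have e : x - y = (x - p x) - (y - p x) := by abel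
    rw [dist_eq_norm, e]
    have h4 := norm_sub_sq_real (x - p x) (y - p x)
    have h5 := sq_nonneg (‖y - p x‖)
    apply le_of_sq_le_sq _ (norm_nonneg _)
    linarith
where
  le_of_sq_le_sq {a b : ℝ} (h : a ^ 2 ≤ b ^ 2) (hb : 0 ≤ b) : a ≤ b := by
    exact abs_le_of_sq_le_sq' h hb |>.2

end proj

lemma lip_null {f : EuclideanSpace ℝ (Fin n) → EuclideanSpace ℝ (Fin n)} {C : NNReal}
    (hf : LipschitzWith C f) {s : Set (EuclideanSpace ℝ (Fin n))} (hs : volume s = 0) :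
    volume (f '' s) = 0 := by
  have hh : (Measure.hausdorffMeasure (Module.finrank ℝ (EuclideanSpace ℝ (Fin n))) :
    Measure (EuclideanSpace ℝ (Fin n))).IsAddHaarMeasure := inferInstance
  set μ : Measure (EuclideanSpace ℝ (Fin n)) :=
    Measure.hausdorffMeasure (Module.finrank ℝ (EuclideanSpace ℝ (Fin n))) with hμ
  have h1 : μ ≪ volume := Measure.absolutelyContinuous_isAddHaarMeasure μ volume
  have h2 : volume ≪ μ := Measure.absolutelyContinuous_isAddHaarMeasure volume μ
  apply h2
  have := hf.hausdorffMeasure_image_le (d := Module.finrank ℝ (EuclideanSpace ℝ (Fin n)))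
    (by positivity) s
  rw [← hμ, h1 hs, mul_zero] at this
  exact le_antisymm this (zero_le)

/-- positivity of determinants of strictly monotone maps -/
lemma det_pos_of_mono (A : EuclideanSpace ℝ (Fin n) →L[ℝ] EuclideanSpace ℝ (Fin n))
    (hA : ∀ v, 0 ≤ inner ℝ (A v) v) {θ : ℝ} (h0 : 0 < θ) (h1 : θ ≤ 1) :
    0 < (θ • ContinuousLinearMap.id ℝ (EuclideanSpace ℝ (Fin n)) + (1 - θ) • A).det := by
  have hne : ∀ t : ℝ, 0 < t → t ≤ 1 →
      (t • ContinuousLinearMap.id ℝ (EuclideanSpace ℝ (Fin n)) + (1 - t) • A).det ≠ 0 := by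
    intro t ht0 ht1 hdet
    have := LinearMap.bot_lt_ker_of_det_eq_zero hdet
    obtain ⟨v, hv, hv0⟩ := Submodule.exists_mem_ne_zero_of_ne_bot this.ne'
    rw [LinearMap.mem_ker] at hv
    have hv' : t • v + (1 - t) • A v = 0 := by simpa using hv
    have : inner ℝ (t • v + (1 - t) • A v) v = 0 := by rw [hv', inner_zero_left]
    rw [inner_add_left, real_inner_smul_left, real_inner_smul_left,
      real_inner_self_eq_norm_sq] at this
    have h3 : 0 < ‖v‖ := norm_pos_iff.2 hv0
    have h4 := mul_nonneg (sub_nonneg.2 ht1) (hA v)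
    have h5 : 0 < t * ‖v‖ ^ 2 := by positivity
    linarith
  by_contra! hneg
  have hcont : Continuous (fun t : ℝ =>
      (t • ContinuousLinearMap.id ℝ (EuclideanSpace ℝ (Fin n)) + (1 - t) • A).det) := by
    apply ContinuousLinearMap.continuous_det.comp
    fun_prop
  have := intermediate_value_Icc h1 hcont.continuousOn
  have h1' : (1:ℝ) = ((1:ℝ) • ContinuousLinearMap.id ℝ (EuclideanSpace ℝ (Fin n)) +
    ((1:ℝ) - 1) • A).det := by
    have : (1:ℝ) • ContinuousLinearMap.id ℝ (EuclideanSpace ℝ (Fin n)) + ((1:ℝ) - 1) • A =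
        ContinuousLinearMap.id ℝ (EuclideanSpace ℝ (Fin n)) := by
      ext v; simp
    rw [this]
    exact LinearMap.det_id.symm
  obtain ⟨t, ht, ht0⟩ := this (show (0:ℝ) ∈ Set.Icc _ _ from ⟨hneg, by rw [← h1']; norm_num⟩)
  exact hne t (h0.trans_le ht.1) ht.2 ht0

/-- the determinant is polynomial in the parameter -/
lemma det_poly (A : EuclideanSpace ℝ (Fin n) →L[ℝ] EuclideanSpace ℝ (Fin n)) :
    ∃ q : Polynomial ℝ, q.natDegree ≤ n ∧ ∀ θ : ℝ,
      (θ • ContinuousLinearMap.id ℝ (EuclideanSpace ℝ (Fin n)) + (1 - θ) • A).det = q.eval θ := by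
  let b := (EuclideanSpace.basisFun (Fin n) ℝ).toBasis
  let M := LinearMap.toMatrix b b (A : EuclideanSpace ℝ (Fin n) →ₗ[ℝ] EuclideanSpace ℝ (Fin n))
  refine ⟨Matrix.det ((Polynomial.X : Polynomial ℝ) • (1 - M).map Polynomial.C +
    M.map Polynomial.C), ?_, ?_⟩
  · simpa using Polynomial.natDegree_det_X_add_C_le (1 - M) M
  · intro θ
    have : (θ • ContinuousLinearMap.id ℝ (EuclideanSpace ℝ (Fin n)) + (1 - θ) • A).det =
      LinearMap.det (θ • LinearMap.id + (1 - θ) • (A : EuclideanSpace ℝ (Fin n) →ₗ[ℝ] EuclideanSpace ℝ (Fin n))) := rfl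
    rw [this, ← LinearMap.det_toMatrix b, ← Polynomial.coe_evalRingHom, RingHom.map_det]
    congr 1
    ext i j
    simp [M]
    ring

end CodimOne

namespace CodimOne

variable {n : ℕ}

lemma mono_fderiv {K : Set (EuclideanSpace ℝ (Fin n))}
    {p : EuclideanSpace ℝ (Fin n) → EuclideanSpace ℝ (Fin n)} (hp : ∀ x, p x ∈ K)
    (hi : ∀ x, ∀ w ∈ K, inner ℝ (x - p x) (w - p x) ≤ 0) {x : EuclideanSpace ℝ (Fin n)}
    (hd : DifferentiableAt ℝ p x) (v : EuclideanSpace ℝ (Fin n)) :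
    0 ≤ inner ℝ (fderiv ℝ p x v) v := by
  have h1 : HasDerivAt (fun t : ℝ => p (x + t • v)) (fderiv ℝ p x v) 0 := by
    have := hd.hasFDerivAt
    have h2 : HasDerivAt (fun t : ℝ => x + t • v) v 0 := by
      simpa using ((hasDerivAt_id (0:ℝ)).smul_const v).const_add x
    have h3 : HasFDerivAt p (fderiv ℝ p x) (x + (0:ℝ) • v) := by simpa using this
    exact h3.comp_hasDerivAt 0 h2
  have h2 := h1.tendsto_slope_zero_right
  have h3 : Filter.Tendsto (fun t : ℝ => inner ℝ (t⁻¹ • (p (x + (0 + t) • v) - p (x + (0:ℝ) • v))) v)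
      (nhdsWithin 0 (Set.Ioi 0)) (nhds (inner ℝ (fderiv ℝ p x v) v)) := h2.inner tendsto_const_nhds
  refine ge_of_tendsto h3 ?_
  filter_upwards [self_mem_nhdsWithin] with t ht
  have ht : 0 < t := ht
  have h4 := proj_firm hp hi (x + t • v) x
  have h5 : x + t • v - x = t • v := by abel
  rw [h5, real_inner_smul_left, real_inner_comm] at h4
  have h6 : 0 ≤ t * inner ℝ (p (x + t • v) - p x) v := le_trans (by positivity) h4
  rw [real_inner_smul_left]
  simp only [zero_add, zero_smul, add_zero]
  have := (mul_nonneg_iff_of_pos_left ht).1 h6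
  positivity

lemma shell_volume {K : Set (EuclideanSpace ℝ (Fin n))} (hK : IsCompact K)
    {p : EuclideanSpace ℝ (Fin n) → EuclideanSpace ℝ (Fin n)} (hp : ∀ x, p x ∈ K)
    (hi : ∀ x, ∀ w ∈ K, inner ℝ (x - p x) (w - p x) ≤ 0) {R θ : ℝ} (hR : 0 < R)
    (h0 : 0 < θ) (h1 : θ ≤ 1) :
    volume {x | 0 < Metric.infDist x K ∧ Metric.infDist x K ≤ θ * R} =
      ∫⁻ x in {x | 0 < Metric.infDist x K ∧ Metric.infDist x K ≤ R} ∩ {x | DifferentiableAt ℝ p x},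
        ENNReal.ofReal
        (θ • ContinuousLinearMap.id ℝ (EuclideanSpace ℝ (Fin n)) + (1 - θ) • fderiv ℝ p x).det := by
  set A := {x | 0 < Metric.infDist x K ∧ Metric.infDist x K ≤ R} with hA
  set D := {x | DifferentiableAt ℝ p x} with hD
  have hlip := proj_lip hp hi
  let Φ : EuclideanSpace ℝ (Fin n) → EuclideanSpace ℝ (Fin n) := fun x => θ • x + (1 - θ) • p x
  have hpΦ : ∀ x, p (Φ x) = p x := by
    intro x
    apply proj_unique hp hi (hp x)
    intro w hw
    have : Φ x - p x = θ • (x - p x) := by simp only [Φ]; module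
    rw [this, real_inner_smul_left]
    exact mul_nonpos_of_nonneg_of_nonpos h0.le (hi x w hw)
  have hinj : Function.Injective Φ := by
    intro x y hxy
    have h2 : p x = p y := by rw [← hpΦ x, ← hpΦ y, hxy]
    simp only [Φ, h2] at hxy
    have := add_right_cancel hxy
    exact smul_right_injective _ h0.ne' this
  have hdist : ∀ x, Metric.infDist (Φ x) K = θ * Metric.infDist x K := by
    intro x
    rw [proj_infDist hp hi, proj_infDist hp hi, hpΦ]
    have : Φ x - p x = θ • (x - p x) := by simp only [Φ]; module
    rw [this, norm_smul, Real.norm_of_nonneg h0.le]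
  have hLipΦ : LipschitzWith (‖θ‖₊ * 1 + ‖1 - θ‖₊ * 1) Φ :=
    ((lipschitzWith_smul θ).comp LipschitzWith.id).add ((lipschitzWith_smul (1 - θ)).comp hlip)
  have himg : Φ '' A = {x | 0 < Metric.infDist x K ∧ Metric.infDist x K ≤ θ * R} := by
    ext z
    constructor
    · rintro ⟨x, hx, rfl⟩
      rw [Set.mem_ofPred_eq, hdist]
      exact ⟨mul_pos h0 hx.1, mul_le_mul_of_nonneg_left hx.2 h0.le⟩
    · intro hz
      have hpx : p (p z + θ⁻¹ • (z - p z)) = p z := by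
        apply proj_unique hp hi (hp z)
        intro w hw
        rw [add_sub_cancel_left, real_inner_smul_left]
        exact mul_nonpos_of_nonneg_of_nonpos (by positivity) (hi z w hw)
      have hΦz : Φ (p z + θ⁻¹ • (z - p z)) = z := by
        simp only [Φ, hpx]
        rw [smul_add, smul_smul, mul_inv_cancel₀ h0.ne']
        module
      refine ⟨p z + θ⁻¹ • (z - p z), ?_, hΦz⟩
      have h3 := hdist (p z + θ⁻¹ • (z - p z))
      rw [hΦz] at h3
      rw [Set.mem_ofPred_eq, h3] at hz
      exact ⟨(mul_pos_iff_of_pos_left h0).1 hz.1, le_of_mul_le_mul_left hz.2 h0⟩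
  have hAm : MeasurableSet A := by
    have hm : Measurable (fun x => Metric.infDist x K) := (Metric.continuous_infDist_pt K).measurable
    exact (measurableSet_lt measurable_const hm).inter (measurableSet_le hm measurable_const)
  have hDm : MeasurableSet D := measurableSet_of_differentiableAt ℝ p
  have hnull : volume (A \ D) = 0 := by
    have := hlip.ae_differentiableAt (μ := volume)
    rw [ae_iff] at this
    exact measure_mono_null (fun x hx => hx.2) this
  have e1 : volume (Φ '' A) = volume (Φ '' (A ∩ D)) := by
    apply le_antisymm
    · have : Φ '' A ⊆ Φ '' (A ∩ D) ∪ Φ '' (A \ D) := by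
        rw [← Set.image_union, Set.inter_union_sdiff]
      calc _ ≤ _ := measure_mono this
        _ ≤ _ := measure_union_le _ _
        _ = _ := by rw [lip_null hLipΦ hnull, add_zero]
    · exact measure_mono (Set.image_mono Set.inter_subset_left)
  rw [← himg, e1, ← lintegral_abs_det_fderiv_eq_addHaar_image volume (hAm.inter hDm)
    (f' := fun x => θ • ContinuousLinearMap.id ℝ (EuclideanSpace ℝ (Fin n)) + (1 - θ) • fderiv ℝ p x)
    ?_ hinj.injOn]
  · apply setLIntegral_congr_fun (hAm.inter hDm)
    intro x hx
    dsimp only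
    rw [abs_of_pos (det_pos_of_mono _ (mono_fderiv hp hi hx.2) h0 h1)]
  · intro x hx
    have h2 : HasFDerivAt p (fderiv ℝ p x) x := DifferentiableAt.hasFDerivAt hx.2
    exact (((hasFDerivAt_id x).const_smul θ).add (h2.const_smul (1 - θ))).hasFDerivWithinAt

lemma cth_eq {K : Set (EuclideanSpace ℝ (Fin n))} (hne : K.Nonempty) {R : ℝ} (hR : 0 ≤ R) :
    Metric.cthickening R K = {x | Metric.infDist x K ≤ R} := by
  ext x
  rw [Metric.mem_cthickening_iff, Set.mem_ofPred_eq, Metric.infDist,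
    ENNReal.le_ofReal_iff_toReal_le (Metric.infEDist_ne_top hne) hR]

lemma volume_le_infDist_lt_top {K : Set (EuclideanSpace ℝ (Fin n))} (hK : IsCompact K) (hne : K.Nonempty)
    (R : ℝ) : volume {x | Metric.infDist x K ≤ R} < ⊤ := by
  by_cases hR : 0 ≤ R
  · have : {x | Metric.infDist x K ≤ R} = Metric.cthickening R K :=
      (cth_eq hne hR).symm
    rw [this]
    exact hK.cthickening.measure_lt_top
  · have : {x | Metric.infDist x K ≤ R} = ∅ := by
      ext x; simp only [Set.mem_ofPred_eq, Set.mem_empty_iff_false, iff_false, not_le]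
      exact (not_le.1 hR).trans_le Metric.infDist_nonneg
    rw [this]; simp

lemma shell_poly {K : Set (EuclideanSpace ℝ (Fin n))} (hK : IsCompact K) (hc : Convex ℝ K)
    (hne : K.Nonempty) {R : ℝ} (hR : 0 < R) :
    ∃ Q : Polynomial ℝ, ∀ ε, 0 < ε → ε ≤ R →
      (volume {x | 0 < Metric.infDist x K ∧ Metric.infDist x K ≤ ε}).toReal = Q.eval ε := by
  obtain ⟨p, hp, hi⟩ := exists_proj K hK hc hne
  set S := {x | 0 < Metric.infDist x K ∧ Metric.infDist x K ≤ R} ∩ {x | DifferentiableAt ℝ p x} with hS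
  have hSm : MeasurableSet S := by
    have hm : Measurable (fun x => Metric.infDist x K) := (Metric.continuous_infDist_pt K).measurable
    exact ((measurableSet_lt measurable_const hm).inter (measurableSet_le hm measurable_const)).inter
      (measurableSet_of_differentiableAt ℝ p)
  let f : ℝ → EuclideanSpace ℝ (Fin n) → ℝ := fun θ x =>
    (θ • ContinuousLinearMap.id ℝ (EuclideanSpace ℝ (Fin n)) + (1 - θ) • fderiv ℝ p x).det
  have hfm : ∀ θ, Measurable (f θ) := by
    intro θ
    apply ContinuousLinearMap.continuous_det.measurable.comp
    exact ((measurable_fderiv ℝ p).const_smul (1 - θ)).const_add _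
  have hpos : ∀ θ, 0 < θ → θ ≤ 1 → 0 ≤ᵐ[volume.restrict S] f θ := by
    intro θ h0 h1
    filter_upwards [ae_restrict_mem hSm] with x hx
    exact (det_pos_of_mono _ (mono_fderiv hp hi hx.2) h0 h1).le
  have hvol := fun θ h0 h1 => shell_volume hK hp hi hR (θ := θ) h0 h1
  have hfin : ∀ θ, volume {x | 0 < Metric.infDist x K ∧ Metric.infDist x K ≤ θ * R} < ⊤ :=
    fun θ => lt_of_le_of_lt (measure_mono fun x hx => hx.2) (volume_le_infDist_lt_top hK hne (θ * R))
  have hintegr : ∀ θ, 0 < θ → θ ≤ 1 → Integrable (f θ) (volume.restrict S) := by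
    intro θ h0 h1
    refine ⟨(hfm θ).aestronglyMeasurable, ?_⟩
    rw [hasFiniteIntegral_iff_ofReal (hpos θ h0 h1), ← hvol θ h0 h1]
    exact hfin θ
  have hval : ∀ θ, 0 < θ → θ ≤ 1 →
      (volume {x | 0 < Metric.infDist x K ∧ Metric.infDist x K ≤ θ * R}).toReal
        = ∫ x in S, f θ x := by
    intro θ h0 h1
    rw [hvol θ h0 h1, integral_eq_lintegral_of_nonneg_ae (hpos θ h0 h1)
      (hfm θ).aestronglyMeasurable]
  let v : ℕ → ℝ := fun j => 1 / ((j : ℝ) + 1)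
  have hv : Set.InjOn v (Finset.range (n + 1)) := by
    intro a _ b _ hab
    simp only [v, one_div, inv_inj, add_left_inj, Nat.cast_inj] at hab
    exact hab
  have hv0 : ∀ j, 0 < v j := fun j => by simp only [v]; positivity
  have hv1 : ∀ j, v j ≤ 1 := fun j => by
    simp only [v]; rw [div_le_one (by positivity)]; linarith [(Nat.cast_nonneg j : (0:ℝ) ≤ j)]
  have hlag : ∀ θ x, f θ x = ∑ j ∈ Finset.range (n + 1),
      f (v j) x * (Lagrange.basis (Finset.range (n + 1)) v j).eval θ := by
    intro θ x
    obtain ⟨q, hq, hqe⟩ := det_poly (fderiv ℝ p x)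
    have hdeg : q.degree < (Finset.range (n + 1)).card := by
      rw [Finset.card_range]
      exact lt_of_le_of_lt Polynomial.degree_le_natDegree (by exact_mod_cast Nat.lt_succ_of_le hq)
    have := Lagrange.eq_interpolate_of_eval_eq (r := fun j => f (v j) x) hv hdeg
      (fun j _ => (hqe (v j)).symm)
    change (θ • ContinuousLinearMap.id ℝ (EuclideanSpace ℝ (Fin n)) + (1 - θ) • fderiv ℝ p x).det = _
    rw [hqe θ, this, Lagrange.interpolate_apply, Polynomial.eval_finsetSum]
    simp
  let Q0 : Polynomial ℝ := ∑ j ∈ Finset.range (n + 1),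
    Polynomial.C (∫ x in S, f (v j) x) * Lagrange.basis (Finset.range (n + 1)) v j
  have hQ0 : ∀ θ, 0 < θ → θ ≤ 1 → ∫ x in S, f θ x = Q0.eval θ := by
    intro θ h0 h1
    simp only [hlag θ]
    rw [integral_finsetSum]
    · simp only [Q0, Polynomial.eval_finsetSum, Polynomial.eval_mul, Polynomial.eval_C,
        integral_mul_const]
    · intro j _
      exact (hintegr (v j) (hv0 j) (hv1 j)).mul_const _
  refine ⟨Q0.comp (Polynomial.C R⁻¹ * Polynomial.X), ?_⟩
  intro ε h0 h1
  have hε : ε = (R⁻¹ * ε) * R := by field_simp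
  rw [Polynomial.eval_comp]
  simp only [Polynomial.eval_mul, Polynomial.eval_C, Polynomial.eval_X]
  rw [← hQ0 _ (by positivity) (by rw [inv_mul_le_iff₀ hR]; linarith), ← hval _ (by positivity)
    (by rw [inv_mul_le_iff₀ hR]; linarith), ← hε]

/-- **Steiner formula.** -/
theorem steiner {K : Set (EuclideanSpace ℝ (Fin n))} (hK : IsCompact K) (hc : Convex ℝ K)
    (hne : K.Nonempty) :
    ∃ P : Polynomial ℝ, ∀ ε, 0 ≤ ε →
      (volume {x | Metric.infDist x K ≤ ε}).toReal = P.eval ε := by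
  have hsplit : ∀ ε, 0 < ε → (volume {x | Metric.infDist x K ≤ ε}).toReal = (volume K).toReal +
      (volume {x | 0 < Metric.infDist x K ∧ Metric.infDist x K ≤ ε}).toReal := by
    intro ε hε
    have hm : Measurable (fun x => Metric.infDist x K) := (Metric.continuous_infDist_pt K).measurable
    have hKm := hK.measurableSet
    have : {x | Metric.infDist x K ≤ ε} = K ∪ {x | 0 < Metric.infDist x K ∧ Metric.infDist x K ≤ ε} := by
      ext x
      simp only [Set.mem_ofPred_eq, Set.mem_union]
      rw [hK.isClosed.mem_iff_infDist_zero hne]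
      have := Metric.infDist_nonneg (x := x) (s := K)
      constructor
      · intro h
        rcases this.eq_or_lt with h' | h'
        · left; exact h'.symm
        · right; exact ⟨h', h⟩
      · rintro (h | h)
        · rw [h]; exact hε.le
        · exact h.2
    rw [this, measure_union, ENNReal.toReal_add hK.measure_lt_top.ne]
    · exact (lt_of_le_of_lt (measure_mono fun x hx => hx.2) (volume_le_infDist_lt_top hK hne ε)).ne
    · rw [Set.disjoint_left]
      intro x hx hx'
      rw [hK.isClosed.mem_iff_infDist_zero hne] at hx
      exact hx'.1.ne' hx
    · exact (measurableSet_lt measurable_const hm).inter (measurableSet_le hm measurable_const)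
  have hQ := fun (R : ℝ) (hR : 0 < R) => shell_poly hK hc hne hR
  obtain ⟨Q, hQ1⟩ := hQ 1 one_pos
  have hall : ∀ ε, 0 < ε →
      (volume {x | 0 < Metric.infDist x K ∧ Metric.infDist x K ≤ ε}).toReal = Q.eval ε := by
    intro ε hε
    obtain ⟨Q', hQ'⟩ := hQ ε hε
    have : Q = Q' := by
      apply Polynomial.eq_of_infinite_eval_eq
      apply Set.Infinite.mono (s := Set.Ioc 0 (min 1 ε))
      · intro t ht
        rw [Set.mem_ofPred_eq, ← hQ1 t ht.1 (ht.2.trans (min_le_left _ _)),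
          ← hQ' t ht.1 (ht.2.trans (min_le_right _ _))]
      · exact Set.Ioc_infinite (lt_min one_pos hε)
    rw [this]; exact hQ' ε hε le_rfl
  refine ⟨Polynomial.C (volume K).toReal + Q, ?_⟩
  have hpos : ∀ ε, 0 < ε → (volume {x | Metric.infDist x K ≤ ε}).toReal =
      (Polynomial.C (volume K).toReal + Q).eval ε := by
    intro ε hε
    rw [hsplit ε hε, hall ε hε, Polynomial.eval_add, Polynomial.eval_C]
  intro ε hε
  rcases hε.eq_or_lt with h | h
  · subst h
    have h1 : Filter.Tendsto (fun ε => (volume {x | Metric.infDist x K ≤ ε}).toReal)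
        (nhdsWithin 0 (Set.Ioi 0)) (nhds (volume {x | Metric.infDist x K ≤ 0}).toReal) := by
      have := tendsto_measure_cthickening_of_isCompact (μ := (volume : Measure (EuclideanSpace ℝ (Fin n)))) hK
      have h2 := (ENNReal.tendsto_toReal hK.measure_lt_top.ne).comp
        (this.mono_left (nhdsWithin_le_nhds (s := Set.Ioi 0)))
      have h3 : {x | Metric.infDist x K ≤ 0} = K := by
        rw [← cth_eq hne le_rfl, Metric.cthickening_zero, hK.isClosed.closure_eq]
      rw [h3]
      refine h2.congr' ?_
      filter_upwards [self_mem_nhdsWithin] with t ht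
      simp only [Function.comp]
      rw [cth_eq hne (le_of_lt ht)]
    have h2 : Filter.Tendsto (fun ε => (Polynomial.C (volume K).toReal + Q).eval ε)
        (nhdsWithin 0 (Set.Ioi 0)) (nhds ((Polynomial.C (volume K).toReal + Q).eval 0)) :=
      ((Polynomial.C (volume K).toReal + Q).continuous.tendsto 0).mono_left nhdsWithin_le_nhds
    refine tendsto_nhds_unique (h1.congr' ?_) h2
    filter_upwards [self_mem_nhdsWithin] with t ht
    exact hpos t ht
  · exact hpos ε h

end CodimOne

namespace CodimOne

variable {n : ℕ}

/-- compact convex (possibly empty) sets -/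
def CC (A : Set (EuclideanSpace ℝ (Fin n))) : Prop := IsCompact A ∧ Convex ℝ A

/-- valuations on compact convex sets -/
structure IsVal (Ψ : Set (EuclideanSpace ℝ (Fin n)) → ℝ) : Prop where
  empty : Ψ ∅ = 0
  val : ∀ A B, CC A → CC B → Convex ℝ (A ∪ B) → Ψ (A ∪ B) = Ψ A + Ψ B - Ψ (A ∩ B)

def Box (a w : Fin n → ℝ) : Set (EuclideanSpace ℝ (Fin n)) := {x | ∀ i, a i ≤ x i ∧ x i ≤ a i + w i}

lemma CC.inter {A B : Set (EuclideanSpace ℝ (Fin n))} (hA : CC A) (hB : CC B) : CC (A ∩ B) :=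
  ⟨hA.1.inter hB.1, hA.2.inter hB.2⟩

lemma CC.inter_closed {A B : Set (EuclideanSpace ℝ (Fin n))} (hA : CC A) (hB : IsClosed B)
    (hB2 : Convex ℝ B) : CC (A ∩ B) :=
  ⟨hA.1.inter_right hB, hA.2.inter hB2⟩

lemma cont_coord (i : Fin n) : Continuous (fun x : EuclideanSpace ℝ (Fin n) => x i) := by fun_prop

lemma lin_coord (i : Fin n) : IsLinearMap ℝ (fun x : EuclideanSpace ℝ (Fin n) => x i) :=
  ⟨fun _ _ => rfl, fun _ _ => rfl⟩

lemma CC.le {A : Set (EuclideanSpace ℝ (Fin n))} (hA : CC A) (i : Fin n) (t : ℝ) :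
    CC (A ∩ {x | x i ≤ t}) :=
  hA.inter_closed (isClosed_le (cont_coord i) continuous_const) (convex_halfSpace_le (lin_coord i) t)

lemma CC.ge {A : Set (EuclideanSpace ℝ (Fin n))} (hA : CC A) (i : Fin n) (t : ℝ) :
    CC (A ∩ {x | t ≤ x i}) :=
  hA.inter_closed (isClosed_le continuous_const (cont_coord i)) (convex_halfSpace_ge (lin_coord i) t)

lemma CC.slab {A : Set (EuclideanSpace ℝ (Fin n))} (hA : CC A) (i : Fin n) (s t : ℝ) :
    CC (A ∩ {x | s ≤ x i ∧ x i ≤ t}) := by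
  have := (hA.ge i s).le i t
  convert this using 1
  ext x; simp [and_assoc]

lemma IsVal.cut {Ψ : Set (EuclideanSpace ℝ (Fin n)) → ℝ} (h : IsVal Ψ)
    {A : Set (EuclideanSpace ℝ (Fin n))} (hA : CC A) (i : Fin n) (t : ℝ) :
    Ψ A = Ψ (A ∩ {x | x i ≤ t}) + Ψ (A ∩ {x | t ≤ x i}) - Ψ (A ∩ {x | x i = t}) := by
  have e1 : A = (A ∩ {x | x i ≤ t}) ∪ (A ∩ {x | t ≤ x i}) := by
    ext x; simp only [Set.mem_union, Set.mem_inter_iff, Set.mem_ofPred_eq]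
    have := le_total (x i) t
    tauto
  have e2 : A ∩ {x | x i = t} = (A ∩ {x | x i ≤ t}) ∩ (A ∩ {x | t ≤ x i}) := by
    ext x; simp only [Set.mem_inter_iff, Set.mem_ofPred_eq, le_antisymm_iff]
    tauto
  rw [e2, ← h.val _ _ (hA.le i t) (hA.ge i t) (by rw [← e1]; exact hA.2), ← e1]

lemma IsVal.slab {Ψ : Set (EuclideanSpace ℝ (Fin n)) → ℝ} (h : IsVal Ψ)
    {A : Set (EuclideanSpace ℝ (Fin n))} (hA : CC A) (i : Fin n)
    (hz : ∀ t, ∀ B ⊆ A, CC B → (∀ x ∈ B, x i = t) → Ψ B = 0) (a w : ℝ) (hw : 0 ≤ w) (N : ℕ) :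
    Ψ (A ∩ {x | a ≤ x i ∧ x i ≤ a + N * w}) =
      ∑ j ∈ Finset.range N, Ψ (A ∩ {x | a + j * w ≤ x i ∧ x i ≤ a + j * w + w}) := by
  induction N with
  | zero =>
    simp only [Finset.range_zero, Finset.sum_empty]
    apply hz a _ Set.inter_subset_left (hA.slab i _ _)
    rintro x ⟨_, h1, h2⟩
    simp at h2
    exact le_antisymm h2 h1
  | succ N ih =>
    rw [Finset.sum_range_succ, ← ih, h.cut (hA.slab i _ _) i (a + N * w)]
    have hN : 0 ≤ (N : ℝ) * w := by positivity
    rw [hz (a + N * w) (_ ∩ {x : EuclideanSpace ℝ (Fin n) | x i = a + N * w})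
      (Set.inter_subset_left.trans Set.inter_subset_left) ?_ (fun x hx => hx.2), sub_zero]
    · congr 2
      · ext x; simp only [Set.mem_inter_iff, Set.mem_ofPred_eq]; push_cast
        constructor
        · rintro ⟨⟨h1, h2, h3⟩, h4⟩; exact ⟨h1, h2, h4⟩
        · rintro ⟨h1, h2, h3⟩; exact ⟨⟨h1, h2, by linarith⟩, h3⟩
      · ext x; simp only [Set.mem_inter_iff, Set.mem_ofPred_eq]; push_cast
        constructor
        · rintro ⟨⟨h1, h2, h3⟩, h4⟩; exact ⟨h1, h4, by linarith⟩
        · rintro ⟨h1, h2, h3⟩; exact ⟨⟨h1, by linarith, by linarith⟩, h2⟩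
    · have := ((hA.slab i a (a + (N + 1 : ℕ) * w)).slab i (a + N * w) (a + N * w))
      convert this using 2
      ext x; simp only [Set.mem_ofPred_eq]
      constructor
      · intro h; rw [h]; simp
      · rintro ⟨h1, h2⟩; linarith

lemma exists_box {A : Set (EuclideanSpace ℝ (Fin n))} (hA : IsCompact A) :
    ∃ R : ℕ, 0 < R ∧ ∃ a, A ⊆ Box a (fun _ => (R : ℝ)) := by
  obtain ⟨C, hC⟩ := hA.isBounded.exists_norm_le
  obtain ⟨m, hm⟩ := exists_nat_ge C
  refine ⟨2 * (m + 1), by omega, fun _ => -(m + 1), ?_⟩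
  intro x hx i
  have h1 := hC x hx
  have h2 : |x i| ≤ ‖x‖ := PiLp.norm_apply_le x i
  have h3 := abs_le.1 (h2.trans (h1.trans hm))
  push_cast
  constructor <;> linarith [h3.1, h3.2]

lemma box_step {N : ℕ} (T : Finset (Fin n)) {i : Fin n} (hi : i ∉ T) (a : Fin n → ℝ) (R r : ℝ) (j : ℕ)
    (hj : j < N) (hr : 0 ≤ r) (hR : R = N * r) :
    Box a (fun k => if k ∈ insert i T then R else r) ∩
      {x | a i + j * r ≤ x i ∧ x i ≤ a i + j * r + r} =
    Box (Function.update a i (a i + j * r)) (fun k => if k ∈ T then R else r) := by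
  ext x
  simp only [Box, Set.mem_inter_iff, Set.mem_ofPred_eq]
  have hj1 : (j : ℝ) * r + r ≤ R := by
    have : (j : ℝ) + 1 ≤ N := by exact_mod_cast hj
    nlinarith
  have hj0 : 0 ≤ (j : ℝ) * r := by positivity
  constructor
  · rintro ⟨h1, h2, h3⟩ k
    by_cases hk : k = i
    · subst hk; simp [hi]; exact ⟨h2, h3⟩
    · have := h1 k
      simp only [Finset.mem_insert, hk, false_or] at this
      simpa [Function.update_of_ne hk] using this
  · intro h1
    have hii := h1 i
    simp only [Function.update_self, hi, if_false] at hii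
    refine ⟨fun k => ?_, hii⟩
    by_cases hk : k = i
    · subst hk
      simp only [Finset.mem_insert_self, if_true]
      constructor <;> linarith [hii.1, hii.2]
    · have := h1 k
      rw [Function.update_of_ne hk] at this
      simpa only [Finset.mem_insert, hk, false_or] using this

lemma box_slab_all {N : ℕ} (T : Finset (Fin n)) (i : Fin n) (a : Fin n → ℝ) (R r : ℝ)
    (hR : R = N * r) :
    Box a (fun k => if k ∈ insert i T then R else r) ⊆ {x | a i ≤ x i ∧ x i ≤ a i + N * r} := by
  intro x hx
  have := hx i
  simp only [Finset.mem_insert_self, if_true] at this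
  rw [hR] at this
  exact this

lemma slice_step {Ψ : Set (EuclideanSpace ℝ (Fin n)) → ℝ} (h : IsVal Ψ) {C r0 : ℝ} (hC : 0 ≤ C)
    (hr0 : 0 < r0)
    (hb : ∀ r, 0 < r → r ≤ r0 → ∀ A, CC A → ∀ a, A ⊆ Box a (fun _ => r) → |Ψ A| ≤ C * r ^ n)
    (S : Finset (Fin n)) (hS : S.Nonempty) (A : Set (EuclideanSpace ℝ (Fin n))) (hA : CC A)
    (hconst : ∀ i ∈ S, ∃ t, ∀ x ∈ A, x i = t)
    (hz : ∀ i ∉ S, ∀ t, ∀ B ⊆ A, CC B → (∀ x ∈ B, x i = t) → Ψ B = 0) : Ψ A = 0 := by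
  obtain ⟨R, hR, a, hAR⟩ := exists_box hA.1
  have hRr : (0:ℝ) < R := by exact_mod_cast hR
  have key : ∀ N : ℕ, 0 < N → (R:ℝ) / N ≤ r0 → |Ψ A| ≤ C * R ^ n / N := by
    intro N hN hNr
    have hNr' : (0:ℝ) < N := by exact_mod_cast hN
    set r : ℝ := R / N with hr
    have hrpos : 0 < r := by positivity
    have hRN : (R:ℝ) = N * r := by rw [hr]; field_simp
    have claim : ∀ T : Finset (Fin n), ∀ B ⊆ A, CC B → ∀ a,
        B ⊆ Box a (fun k => if k ∈ T then (R:ℝ) else r) → |Ψ B| ≤ N ^ (T \ S).card * (C * r ^ n) := by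
      intro T
      induction T using Finset.induction_on with
      | empty =>
        intro B hBA hB a hBa
        simpa using hb r hrpos hNr B hB a (by simpa using hBa)
      | insert i T hi ih =>
        intro B hBA hB a hBa
        by_cases hiS : i ∈ S
        · rw [Finset.insert_sdiff_of_mem _ hiS]
          obtain ⟨t, ht⟩ := hconst i hiS
          apply ih B hBA hB (Function.update a i t)
          intro x hx k
          by_cases hk : k = i
          · subst hk
            simp only [Function.update_self, hi, if_false, ht x (hBA hx)]
            constructor <;> linarith
          · have := hBa hx k
            simp only [Finset.mem_insert, hk, false_or] at this
            simpa [Function.update_of_ne hk] using this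
        · rw [Finset.insert_sdiff_of_notMem _ hiS, Finset.card_insert_of_notMem (by simp [hi])]
          have e : B = B ∩ {x | a i ≤ x i ∧ x i ≤ a i + N * r} :=
            (Set.inter_eq_left.2 (hBa.trans (box_slab_all T i a R r hRN))).symm
          rw [e, h.slab hB i (fun t B' hB' => hz i hiS t B' (hB'.trans hBA)) (a i) r hrpos.le N]
          calc _ ≤ ∑ j ∈ Finset.range N, |Ψ (B ∩ {x | a i + j * r ≤ x i ∧ x i ≤ a i + j * r + r})| :=
                Finset.abs_sum_le_sum_abs _ _
            _ ≤ ∑ j ∈ Finset.range N, (N:ℝ) ^ (T \ S).card * (C * r ^ n) := by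
                apply Finset.sum_le_sum
                intro j hj
                apply ih _ (Set.inter_subset_left.trans hBA) (hB.slab i _ _)
                  (Function.update a i (a i + j * r))
                rw [← box_step T hi a R r j (Finset.mem_range.1 hj) hrpos.le hRN]
                exact Set.inter_subset_inter_left _ hBa
            _ = _ := by rw [Finset.sum_const, Finset.card_range, nsmul_eq_mul]; ring
    have := claim Finset.univ A subset_rfl hA a (by simpa using hAR)
    refine this.trans ?_
    have hcard : (Finset.univ \ S).card + 1 ≤ n := by
      have h1 := Finset.card_sdiff_add_card_eq_card (Finset.subset_univ S)
      have h2 := hS.card_pos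
      simp only [Finset.card_univ, Fintype.card_fin] at h1
      omega
    rw [hr, div_pow, le_div_iff₀ hNr']
    have h3 : (N:ℝ) ^ (Finset.univ \ S).card * N ≤ N ^ n := by
      rw [← pow_succ]; exact pow_le_pow_right₀ (by exact_mod_cast hN) hcard
    calc _ = (C * R ^ n) * ((N:ℝ) ^ (Finset.univ \ S).card * N) / N ^ n := by ring
      _ ≤ (C * R ^ n) * (N ^ n) / N ^ n := by gcongr
      _ = _ := by field_simp
  have hlim : Filter.Tendsto (fun N : ℕ => C * (R:ℝ) ^ n / N) Filter.atTop (nhds 0) :=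
    tendsto_const_div_atTop_nhds_zero_nat _
  have hlim2 : Filter.Tendsto (fun N : ℕ => (R:ℝ) / N) Filter.atTop (nhds 0) :=
    tendsto_const_div_atTop_nhds_zero_nat _
  have : |Ψ A| ≤ 0 := by
    refine ge_of_tendsto hlim ?_
    filter_upwards [Filter.eventually_gt_atTop 0, hlim2.eventually (ge_mem_nhds hr0)] with N h1 h2
    exact key N h1 h2
  exact abs_nonpos_iff.1 this

lemma slice_zero {Ψ : Set (EuclideanSpace ℝ (Fin n)) → ℝ} (h : IsVal Ψ) {C r0 : ℝ} (hC : 0 ≤ C)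
    (hr0 : 0 < r0)
    (hb : ∀ r, 0 < r → r ≤ r0 → ∀ A, CC A → ∀ a, A ⊆ Box a (fun _ => r) → |Ψ A| ≤ C * r ^ n)
    (m : ℕ) : ∀ (S : Finset (Fin n)), S.card + m = n → S.Nonempty →
    ∀ (A : Set (EuclideanSpace ℝ (Fin n))), CC A →
    (∀ i ∈ S, ∃ t, ∀ x ∈ A, x i = t) → Ψ A = 0 := by
  induction m with
  | zero =>
    intro S hc hS A hA hconst
    apply slice_step h hC hr0 hb S hS A hA hconst
    intro i hi
    exfalso
    have : S = Finset.univ := by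
      rw [← Finset.card_eq_iff_eq_univ]; simpa using hc
    exact hi (this ▸ Finset.mem_univ i)
  | succ m ih =>
    intro S hc hS A hA hconst
    apply slice_step h hC hr0 hb S hS A hA hconst
    intro i hi t B hBA hB hBt
    apply ih (insert i S) (by rw [Finset.card_insert_of_notMem hi]; omega) (Finset.insert_nonempty _ _) B hB
    intro k hk
    rcases Finset.mem_insert.1 hk with rfl | hk
    · exact ⟨t, hBt⟩
    · obtain ⟨t', ht'⟩ := hconst k hk
      exact ⟨t', fun x hx => ht' x (hBA hx)⟩

lemma slice_zero_one {Ψ : Set (EuclideanSpace ℝ (Fin n)) → ℝ} (h : IsVal Ψ) {C r0 : ℝ} (hC : 0 ≤ C)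
    (hr0 : 0 < r0)
    (hb : ∀ r, 0 < r → r ≤ r0 → ∀ A, CC A → ∀ a, A ⊆ Box a (fun _ => r) → |Ψ A| ≤ C * r ^ n)
    (i : Fin n) (t : ℝ) (A : Set (EuclideanSpace ℝ (Fin n))) (hA : CC A) (ht : ∀ x ∈ A, x i = t) :
    Ψ A = 0 := by
  apply slice_zero h hC hr0 hb (n - 1) {i} _ (Finset.singleton_nonempty i) A hA
  · intro k hk; rw [Finset.mem_singleton] at hk; subst hk; exact ⟨t, ht⟩
  · have := i.pos
    simp; omega

end CodimOne

namespace CodimOne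

variable {n : ℕ}

lemma box_eq_pre (a w : Fin n → ℝ) :
    Box a w = (WithLp.ofLp : EuclideanSpace ℝ (Fin n) → _) ⁻¹' (Set.Icc a (a + w)) := by
  ext x
  simp only [Box, Set.mem_ofPred_eq, Set.mem_preimage, Set.mem_Icc, Pi.le_def, Pi.add_apply]
  exact forall_and

lemma volume_box (a w : Fin n → ℝ) : volume (Box a w) = ∏ i, ENNReal.ofReal (w i) := by
  rw [box_eq_pre, (PiLp.volume_preserving_ofLp (Fin n)).measure_preimage
    measurableSet_Icc.nullMeasurableSet, Real.volume_Icc_pi]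
  simp

lemma box_closed (a w : Fin n → ℝ) : IsClosed (Box a w) := by
  rw [box_eq_pre]
  exact isClosed_Icc.preimage (PiLp.continuous_ofLp _ _)

lemma box_convex (a w : Fin n → ℝ) : Convex ℝ (Box a w) := by
  have : Box a w = ⋂ i, ({x | a i ≤ x i} ∩ {x : EuclideanSpace ℝ (Fin n) | x i ≤ a i + w i}) := by
    ext x; simp [Box]
  rw [this]
  exact convex_iInter fun i => (convex_halfSpace_ge (lin_coord i) _).inter (convex_halfSpace_le (lin_coord i) _)

lemma box_dist {a : Fin n → ℝ} {r : ℝ} (hr : 0 ≤ r) {x y : EuclideanSpace ℝ (Fin n)}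
    (hx : x ∈ Box a (fun _ => r)) (hy : y ∈ Box a (fun _ => r)) : dist x y ≤ (n + 1) * r := by
  rw [EuclideanSpace.dist_eq]
  apply Real.sqrt_le_iff.2
  refine ⟨by positivity, ?_⟩
  calc ∑ i, dist (x i) (y i) ^ 2 ≤ ∑ i : Fin n, r ^ 2 := by
        apply Finset.sum_le_sum
        intro i _
        apply pow_le_pow_left₀ dist_nonneg
        rw [Real.dist_eq, abs_le]
        have h1 := hx i; have h2 := hy i
        constructor <;> linarith [h1.1, h1.2, h2.1, h2.2]
    _ = n * r ^ 2 := by simp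
    _ ≤ _ := by
      rw [mul_pow]; gcongr; nlinarith [(Nat.cast_nonneg n : (0:ℝ) ≤ n)]

lemma box_cc (a : Fin n → ℝ) (w : Fin n → ℝ) : CC (Box a w) := by
  refine ⟨?_, box_convex a w⟩
  apply Metric.isCompact_of_isClosed_isBounded (box_closed a w)
  rw [box_eq_pre]
  have : Bornology.IsBounded (Set.Icc a (a + w)) := Metric.isBounded_Icc _ _
  exact (PiLp.antilipschitzWith_ofLp 2 (fun _ : Fin n => ℝ)).isBounded_preimage this

lemma isVal_vol {U : Set (EuclideanSpace ℝ (Fin n))} (hU : MeasurableSet U) :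
    IsVal (fun B => (volume (U ∩ B)).toReal) := by
  constructor
  · simp
  · intro A B hA hB _
    have hf : ∀ D : Set (EuclideanSpace ℝ (Fin n)), CC D → volume (U ∩ D) ≠ ⊤ := fun D hD =>
      ((measure_mono Set.inter_subset_right).trans_lt hD.1.measure_lt_top).ne
    have h := measure_union_add_inter (μ := volume) (U ∩ A) (hU.inter hB.1.measurableSet)
    rw [← Set.inter_union_distrib_left, show U ∩ A ∩ (U ∩ B) = U ∩ (A ∩ B) by
      ext x; simp only [Set.mem_inter_iff]; tauto] at h
    have h2 := congrArg ENNReal.toReal h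
    rw [ENNReal.toReal_add, ENNReal.toReal_add (hf A hA) (hf B hB)] at h2
    · linarith
    · rw [Set.inter_union_distrib_left]
      exact (measure_union_lt_top (hf A hA).lt_top (hf B hB).lt_top).ne
    · exact hf _ (hA.inter hB)

lemma vol_slice {B : Set (EuclideanSpace ℝ (Fin n))} (hB : CC B) (i : Fin n) (t : ℝ)
    (ht : ∀ x ∈ B, x i = t) : volume B = 0 := by
  obtain ⟨R, hR, a, ha⟩ := exists_box hB.1
  have : B ⊆ Box (Function.update a i t) (fun k => if k = i then 0 else R) := by
    intro x hx k
    by_cases hk : k = i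
    · subst hk; simp [ht x hx]
    · simpa [hk] using ha hx k
  apply measure_mono_null this
  rw [volume_box]
  apply Finset.prod_eq_zero (Finset.mem_univ i)
  simp

lemma meets_frontier {X : Type*} [TopologicalSpace X] {s t : Set X} (hs : IsPreconnected s)
    (h1 : (s ∩ t).Nonempty) (h2 : (s ∩ tᶜ).Nonempty) : (s ∩ frontier t).Nonempty := by
  by_contra hne
  rw [Set.not_nonempty_iff_eq_empty] at hne
  have hx : ∀ x ∈ s, x ∉ frontier t := fun x hx hf => by
    have : x ∈ s ∩ frontier t := ⟨hx, hf⟩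
    rw [hne] at this; exact this
  have e : ∀ x ∈ s, x ∈ interior t ∨ x ∈ interior tᶜ := by
    intro x h
    have := hx x h
    rw [frontier, interior_compl] at *
    by_cases h3 : x ∈ closure t
    · left; by_contra h4; exact this ⟨h3, h4⟩
    · right; exact h3
  obtain ⟨y, hy, h5, h6⟩ := hs (interior t) (interior tᶜ) isOpen_interior isOpen_interior e
    (by
      obtain ⟨y, hy, h3⟩ := h1
      refine ⟨y, hy, (e y hy).resolve_right fun h4 => interior_subset h4 h3⟩)
    (by
      obtain ⟨y, hy, h3⟩ := h2
      refine ⟨y, hy, (e y hy).resolve_left fun h4 => h3 (interior_subset h4)⟩)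
  exact interior_subset h6 (interior_subset h5)

lemma g_zero {Ψ : Set (EuclideanSpace ℝ (Fin n)) → ℝ} (h : IsVal Ψ) {C r0 : ℝ} (hC : 0 ≤ C)
    (hr0 : 0 < r0)
    (hb : ∀ r, 0 < r → r ≤ r0 → ∀ A, CC A → ∀ a, A ⊆ Box a (fun _ => r) → |Ψ A| ≤ C * r ^ n)
    (hz : ∀ M : ℕ, 0 < M → ∀ a, Ψ (Box a (fun _ => 1 / (M:ℝ))) = 0)
    (A : Set (EuclideanSpace ℝ (Fin n))) (hA : CC A) : Ψ A = 0 := by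
  obtain ⟨R, hR, a, hAR⟩ := exists_box hA.1
  have key : ∀ M : ℕ, 0 < M → 1 / (M:ℝ) ≤ r0 →
      |Ψ A| ≤ C * (volume (Metric.cthickening ((n + 1) * (1 / (M:ℝ))) (frontier A))).toReal := by
    intro M hM hMr
    set r : ℝ := 1 / M with hr
    have hM' : (0:ℝ) < M := by exact_mod_cast hM
    have hrpos : 0 < r := by positivity
    have hRN : (R:ℝ) = ((R * M : ℕ) : ℝ) * r := by rw [hr]; push_cast; field_simp
    set U := Metric.cthickening ((n + 1) * r) (frontier A) with hU
    have hUm : MeasurableSet U := Metric.isClosed_cthickening.measurableSet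
    have hUc : IsCompact U := (hA.1.of_isClosed_subset isClosed_frontier
      (frontier_subset_iff_isClosed.2 hA.1.isClosed)).cthickening
    have claim : ∀ T : Finset (Fin n), ∀ a,
        |Ψ (A ∩ Box a (fun k => if k ∈ T then (R:ℝ) else r))| ≤
        C * (volume (U ∩ Box a (fun k => if k ∈ T then (R:ℝ) else r))).toReal := by
      intro T
      induction T using Finset.induction_on with
      | empty =>
        intro a
        simp only [Finset.notMem_empty, if_false]
        by_cases h1 : Box a (fun _ => r) ⊆ A
        · rw [Set.inter_eq_right.2 h1, hr, hz M hM a, abs_zero]; positivity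
        by_cases h2 : A ∩ Box a (fun _ => r) = ∅
        · rw [h2, h.empty, abs_zero]; positivity
        have h3 : (Box a (fun _ => r) ∩ frontier A).Nonempty := by
          apply meets_frontier (box_convex a _).isPreconnected
          · rw [Set.inter_comm]; exact Set.nonempty_iff_ne_empty.2 h2
          · rw [Set.inter_compl_nonempty_iff]; exact h1
        obtain ⟨y, hy1, hy2⟩ := h3
        have h4 : Box a (fun _ => r) ⊆ U := fun x hx =>
          Metric.mem_cthickening_of_dist_le x y _ _ hy2 (box_dist hrpos.le hx hy1)
        rw [Set.inter_eq_right.2 h4, volume_box]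
        refine (hb r hrpos hMr _ (hA.inter (box_cc a _)) a Set.inter_subset_right).trans ?_
        simp [hrpos.le]
      | insert i T hi ih =>
        intro a
        have e : ∀ B : Set (EuclideanSpace ℝ (Fin n)), B ∩ Box a (fun k => if k ∈ insert i T then (R:ℝ) else r)
          = (B ∩ Box a (fun k => if k ∈ insert i T then (R:ℝ) else r)) ∩
            {x | a i ≤ x i ∧ x i ≤ a i + (R * M : ℕ) * r} := fun B =>
          (Set.inter_eq_left.2 (Set.inter_subset_right.trans (box_slab_all T i a R r hRN))).symm
        have s1 := h.slab (hA.inter (box_cc a (fun k => if k ∈ insert i T then (R:ℝ) else r))) i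
          (fun t B _ hB ht => slice_zero_one h hC hr0 hb i t B hB ht) (a i) r hrpos.le (R * M)
        have s2 := (isVal_vol hUm).slab (box_cc a (fun k => if k ∈ insert i T then (R:ℝ) else r)) i
          (fun t B _ hB ht => by
            rw [measure_mono_null Set.inter_subset_right (vol_slice hB i t ht)]; rfl)
            (a i) r hrpos.le (R * M)
        rw [← e] at s1
        simp only [← Set.inter_assoc] at s2
        rw [← e] at s2
        rw [s1, s2, Finset.mul_sum]
        refine (Finset.abs_sum_le_sum_abs _ _).trans (Finset.sum_le_sum ?_)
        intro j hj
        have e3 := box_step T hi a R r j (Finset.mem_range.1 hj) hrpos.le hRN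
        rw [Set.inter_assoc, Set.inter_assoc, e3]
        exact ih _
    have := claim Finset.univ a
    simp only [Finset.mem_univ, if_true] at this
    rw [Set.inter_eq_left.2 hAR] at this
    refine this.trans ?_
    apply mul_le_mul_of_nonneg_left _ hC
    apply ENNReal.toReal_mono hUc.measure_lt_top.ne (measure_mono Set.inter_subset_left)
  have hfc : IsCompact (frontier A) := hA.1.of_isClosed_subset isClosed_frontier
      (frontier_subset_iff_isClosed.2 hA.1.isClosed)
  have hl0 : Filter.Tendsto (fun M : ℕ => 1 / (M:ℝ)) Filter.atTop (nhds 0) :=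
    tendsto_const_div_atTop_nhds_zero_nat _
  have hl1 : Filter.Tendsto (fun M : ℕ => ((n:ℝ) + 1) * (1 / (M:ℝ))) Filter.atTop (nhds 0) := by
    simpa using hl0.const_mul ((n:ℝ) + 1)
  have hl2 := (tendsto_measure_cthickening_of_isCompact (μ := volume) hfc).comp hl1
  rw [hA.2.addHaar_frontier volume] at hl2
  have hl3 := ((ENNReal.tendsto_toReal ENNReal.zero_ne_top).comp hl2).const_mul C
  simp only [ENNReal.toReal_zero, mul_zero] at hl3
  have : |Ψ A| ≤ 0 := by
    refine ge_of_tendsto hl3 ?_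
    filter_upwards [Filter.eventually_gt_atTop 0, hl0.eventually (ge_mem_nhds hr0)] with M h1 h2
    exact key M h1 h2
  exact abs_nonpos_iff.1 this

lemma box_translate (a w : Fin n → ℝ) :
    Box a w = (fun v => v + WithLp.toLp 2 a) '' Box 0 w := by
  ext x
  constructor
  · intro hx
    refine ⟨x - WithLp.toLp 2 a, fun i => ?_, by simp⟩
    have := hx i
    simp only [Pi.zero_apply, PiLp.sub_apply]
    constructor <;> linarith [this.1, this.2]
  · rintro ⟨y, hy, rfl⟩ i
    have := hy i
    simp only [Pi.zero_apply, zero_add] at this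
    simp only [PiLp.add_apply]
    constructor <;> linarith [this.1, this.2]

theorem lemmaG {Ψ : Set (EuclideanSpace ℝ (Fin n)) → ℝ} (h : IsVal Ψ) {C r0 : ℝ} (hC : 0 ≤ C)
    (hr0 : 0 < r0) (ht : ∀ A x, CC A → Ψ ((fun v => v + x) '' A) = Ψ A)
    (hb : ∀ r, 0 < r → r ≤ r0 → ∀ A, CC A → ∀ x, A ⊆ Metric.closedBall x r → |Ψ A| ≤ C * r ^ n) :
    ∃ c : ℝ, ∀ A, CC A → Ψ A = c * (volume A).toReal := by
  have hN : (0:ℝ) < n + 1 := by positivity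
  set c := Ψ (Box 0 (fun _ => 1))
  refine ⟨c, ?_⟩
  have hv := isVal_vol (n := n) MeasurableSet.univ
  simp only [Set.univ_inter] at hv
  have h' : IsVal (fun A => Ψ A - c * (volume A).toReal) := by
    constructor
    · simp [h.empty]
    · intro A B hA hB hAB
      have h1 := h.val A B hA hB hAB
      have h2 := hv.val A B hA hB hAB
      rw [h1, h2]; ring
  have hb' : ∀ r, 0 < r → r ≤ r0 / (n + 1) → ∀ A : Set (EuclideanSpace ℝ (Fin n)), CC A → ∀ a, A ⊆ Box a (fun _ => r) →
      |Ψ A - c * (volume A).toReal| ≤ (C * (n + 1) ^ n + |c|) * r ^ n := by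
    intro r hr hr1 A hA a hAa
    have h1 := hb ((n + 1) * r) (by positivity) (by rw [le_div_iff₀ hN] at hr1; linarith) A hA (WithLp.toLp 2 a)
      (fun x hx => Metric.mem_closedBall.2 (box_dist hr.le (hAa hx) (fun i => by simp [hr.le])))
    have h2 : (volume A).toReal ≤ r ^ n := by
      have := ENNReal.toReal_mono (box_cc a (fun _ => r)).1.measure_lt_top.ne (measure_mono (μ := volume) hAa)
      rw [volume_box] at this
      simpa [hr.le] using this
    calc _ ≤ |Ψ A| + |c * (volume A).toReal| := abs_sub _ _
      _ ≤ C * ((n + 1) * r) ^ n + |c| * r ^ n := by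
        rw [abs_mul, abs_of_nonneg (ENNReal.toReal_nonneg (a := volume A))]; gcongr
      _ = _ := by rw [mul_pow]; ring
  have hC' : 0 ≤ C * (n + 1 : ℝ) ^ n + |c| := by positivity
  have hr0' : 0 < r0 / (n + 1 : ℝ) := by positivity
  have htr : ∀ a w : Fin n → ℝ, Ψ (Box a w) - c * (volume (Box a w)).toReal =
      Ψ (Box 0 w) - c * (volume (Box 0 w)).toReal := by
    intro a w
    rw [volume_box, volume_box, box_translate a w, ht _ _ (box_cc 0 w)]
  have hz : ∀ M : ℕ, 0 < M → ∀ a, Ψ (Box a (fun _ => 1 / (M:ℝ))) - c * (volume (Box a (fun _ => 1 / (M:ℝ)))).toReal = 0 := by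
    intro M hM a
    have hM' : (0:ℝ) < M := by exact_mod_cast hM
    rw [htr]
    have claim : ∀ T : Finset (Fin n), ∀ a,
      Ψ (Box a (fun k => if k ∈ T then (1:ℝ) else 1 / M)) - c * (volume (Box a (fun k => if k ∈ T then (1:ℝ) else 1 / M))).toReal
      = (M:ℝ) ^ T.card * (Ψ (Box 0 (fun _ => 1 / (M:ℝ))) - c * (volume (Box (0 : Fin n → ℝ) (fun _ => 1 / (M:ℝ)))).toReal) := by
      intro T
      induction T using Finset.induction_on with
      | empty => intro a; simp only [Finset.notMem_empty, if_false]; rw [htr]; simp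
      | insert i T hi ih =>
        intro a
        have hRN : (1:ℝ) = M * (1 / (M:ℝ)) := by field_simp
        have s1 := h'.slab (box_cc a (fun k => if k ∈ insert i T then (1:ℝ) else 1 / M)) i
          (fun t B _ hB ht => slice_zero_one h' hC' hr0' hb' i t B hB ht) (a i) (1 / M) (by positivity) M
        rw [Set.inter_eq_left.2 (box_slab_all T i a 1 (1 / (M:ℝ)) hRN)] at s1
        rw [s1, Finset.card_insert_of_notMem hi]
        refine (Finset.sum_congr rfl (g := fun _ => (M:ℝ) ^ T.card * (Ψ (Box 0 (fun _ => 1 / (M:ℝ)))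
          - c * (volume (Box (0 : Fin n → ℝ) (fun _ => 1 / (M:ℝ)))).toReal)) ?_).trans ?_
        · intro j hj
          rw [box_step T hi a 1 (1 / (M:ℝ)) j (Finset.mem_range.1 hj) (by positivity) hRN, ih]
        · rw [Finset.sum_const, Finset.card_range, nsmul_eq_mul]; ring
    have h1 := claim Finset.univ 0
    simp only [Finset.mem_univ, if_true] at h1
    have h2 : (volume (Box (0 : Fin n → ℝ) (fun _ => 1))).toReal = 1 := by rw [volume_box]; simp
    rw [h2] at h1
    have h3 : Ψ (Box 0 (fun _ => 1)) - c * 1 = 0 := by simp [c]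
    rw [h3] at h1
    rcases mul_eq_zero.1 h1.symm with h4 | h4
    · exact absurd h4 (by positivity)
    · exact h4
  intro A hA
  have := g_zero h' hC' hr0' hb' hz A hA
  linarith

end CodimOne

namespace CodimOne

variable {n : ℕ}

lemma isClosed_convex_nc : IsClosed {L : TopologicalSpace.NonemptyCompacts (EuclideanSpace ℝ (Fin n)) |
    Convex ℝ (L : Set (EuclideanSpace ℝ (Fin n)))} := by
  apply isClosed_of_closure_subset
  intro L hL
  rw [Metric.mem_closure_iff] at hL
  intro x hx y hy a b ha hb hab
  rw [← L.isCompact.isClosed.closure_eq, Metric.mem_closure_iff]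
  intro ε hε
  obtain ⟨L', hL', hd⟩ := hL (ε / 2) (by linarith)
  rw [Metric.NonemptyCompacts.dist_eq] at hd
  have hfin : Metric.hausdorffEDist (L : Set (EuclideanSpace ℝ (Fin n))) L' ≠ ⊤ :=
    Metric.hausdorffEDist_ne_top_of_nonempty_of_bounded L.nonempty L'.nonempty L.isCompact.isBounded
      L'.isCompact.isBounded
  obtain ⟨x', hx', hxx⟩ := Metric.exists_dist_lt_of_hausdorffDist_lt hx hd hfin
  obtain ⟨y', hy', hyy⟩ := Metric.exists_dist_lt_of_hausdorffDist_lt hy hd hfin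
  have hz := hL' hx' hy' ha hb hab
  obtain ⟨z, hz', hzz⟩ := Metric.exists_dist_lt_of_hausdorffDist_lt' hz hd hfin
  refine ⟨z, hz', ?_⟩
  have : dist (a • x + b • y) (a • x' + b • y') ≤ ε / 2 := by
    rw [dist_eq_norm] at hxx hyy ⊢
    have e : a • x + b • y - (a • x' + b • y') = a • (x - x') + b • (y - y') := by
      simp only [smul_sub]; abel
    rw [e]
    refine (norm_add_le _ _).trans ?_
    rw [norm_smul, norm_smul, Real.norm_of_nonneg ha, Real.norm_of_nonneg hb]
    nlinarith
  rw [dist_comm] at hzz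
  linarith [dist_triangle (a • x + b • y) (a • x' + b • y') z]

lemma isCompact_bodies (R : ℝ) : IsCompact {K : ConvexBody (EuclideanSpace ℝ (Fin n)) |
    (K : Set (EuclideanSpace ℝ (Fin n))) ⊆ Metric.closedBall 0 R} := by
  let j : ConvexBody (EuclideanSpace ℝ (Fin n)) → TopologicalSpace.NonemptyCompacts (EuclideanSpace ℝ (Fin n)) :=
    fun K => ⟨⟨K, K.isCompact⟩, K.nonempty⟩
  have hj : Isometry j := by
    apply Isometry.of_dist_eq
    intro K L
    rw [Metric.NonemptyCompacts.dist_eq, ← ConvexBody.hausdorffDist_coe]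
    rfl
  rw [hj.isUniformInducing.isInducing.isCompact_iff]
  have e : j '' {K : ConvexBody (EuclideanSpace ℝ (Fin n)) |
      (K : Set (EuclideanSpace ℝ (Fin n))) ⊆ Metric.closedBall 0 R} =
      {L : TopologicalSpace.NonemptyCompacts (EuclideanSpace ℝ (Fin n)) |
        (L : Set (EuclideanSpace ℝ (Fin n))) ⊆ Metric.closedBall 0 R} ∩
      {L : TopologicalSpace.NonemptyCompacts (EuclideanSpace ℝ (Fin n)) | Convex ℝ (L : Set (EuclideanSpace ℝ (Fin n)))} := by
    ext L
    constructor
    · rintro ⟨K, hK, rfl⟩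
      exact ⟨hK, K.convex⟩
    · rintro ⟨h1, h2⟩
      refine ⟨⟨L, h2, L.isCompact, L.nonempty⟩, h1, ?_⟩
      rfl
  rw [e]
  exact (TopologicalSpace.NonemptyCompacts.isCompact_subsets_of_isCompact
    (isCompact_closedBall 0 R)).inter_right isClosed_convex_nc

/-- closeness in the Hausdorff sense -/
def Close (δ : ℝ) (A B : Set (EuclideanSpace ℝ (Fin n))) : Prop :=
  (∀ x ∈ A, ∃ y ∈ B, dist x y ≤ δ) ∧ (∀ y ∈ B, ∃ x ∈ A, dist y x ≤ δ)

/-- set functions with all the properties we need -/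
structure Good (G : Subgroup ((EuclideanSpace ℝ (Fin n)) ≃ₗᵢ[ℝ] (EuclideanSpace ℝ (Fin n))))
    (F : Set (EuclideanSpace ℝ (Fin n)) → ℝ) : Prop where
  isVal : IsVal F
  transl : ∀ A x, CC A → F ((fun v => v + x) '' A) = F A
  hom : ∀ (lam : ℝ) A, 0 < lam → CC A → F (lam • A) = lam ^ (n - 1) * F A
  inv : ∀ g ∈ G, ∀ A, CC A → F (g '' A) = F A
  bdd : ∀ R, ∃ M, 0 ≤ M ∧ ∀ A, CC A → A ⊆ Metric.closedBall 0 R → |F A| ≤ M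
  unif : ∀ R ε, 0 < ε → ∃ δ, 0 < δ ∧ ∀ A B, CC A → CC B → A.Nonempty → B.Nonempty →
    A ⊆ Metric.closedBall 0 R → B ⊆ Metric.closedBall 0 R → Close δ A B → |F A - F B| < ε

open Classical in
/-- extension of a functional on bodies to all sets -/
noncomputable def ext (φ : ConvexBody (EuclideanSpace ℝ (Fin n)) → ℝ) (A : Set (EuclideanSpace ℝ (Fin n))) : ℝ :=
  if h : CC A ∧ A.Nonempty then φ ⟨A, h.1.2, h.1.1, h.2⟩ else 0

lemma ext_coe (φ : ConvexBody (EuclideanSpace ℝ (Fin n)) → ℝ) (K : ConvexBody (EuclideanSpace ℝ (Fin n))) :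
    ext φ (K : Set (EuclideanSpace ℝ (Fin n))) = φ K := by
  unfold ext
  rw [dif_pos ⟨⟨K.isCompact, K.convex⟩, K.nonempty⟩]
  congr 1

lemma ext_empty (φ : ConvexBody (EuclideanSpace ℝ (Fin n)) → ℝ) : ext φ ∅ = 0 := by
  unfold ext
  rw [dif_neg]
  rintro ⟨_, h⟩
  simp at h

lemma exists_body {A : Set (EuclideanSpace ℝ (Fin n))} (hA : CC A) (hne : A.Nonempty) :
    ∃ K : ConvexBody (EuclideanSpace ℝ (Fin n)), (K : Set (EuclideanSpace ℝ (Fin n))) = A :=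
  ⟨⟨A, hA.2, hA.1, hne⟩, rfl⟩

lemma CC.translate {A : Set (EuclideanSpace ℝ (Fin n))} (hA : CC A) (x : EuclideanSpace ℝ (Fin n)) :
    CC ((fun v => v + x) '' A) :=
  ⟨hA.1.image (by fun_prop), by
    have := hA.2.translate x
    rw [show (fun v => v + x) = (fun v => x + v) from funext fun v => add_comm v x]
    exact this⟩

lemma CC.smul {A : Set (EuclideanSpace ℝ (Fin n))} (hA : CC A) (lam : ℝ) : CC (lam • A) :=
  ⟨hA.1.smul lam, hA.2.smul lam⟩

lemma CC.iso {A : Set (EuclideanSpace ℝ (Fin n))} (hA : CC A)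
    (g : (EuclideanSpace ℝ (Fin n)) ≃ₗᵢ[ℝ] (EuclideanSpace ℝ (Fin n))) : CC (g '' A) :=
  ⟨hA.1.image g.continuous, by
    have := hA.2.is_linear_image (f := g) ⟨fun x y => map_add g x y, fun c x => map_smul g c x⟩
    exact this⟩

theorem good_ext (G : Subgroup ((EuclideanSpace ℝ (Fin n)) ≃ₗᵢ[ℝ] (EuclideanSpace ℝ (Fin n))))
    (φ : ConvexBody (EuclideanSpace ℝ (Fin n)) → ℝ)
    (hval : ∀ K L KL KI : ConvexBody (EuclideanSpace ℝ (Fin n)),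
      (KL : Set (EuclideanSpace ℝ (Fin n))) = ↑K ∪ ↑L →
      (KI : Set (EuclideanSpace ℝ (Fin n))) = ↑K ∩ ↑L →
      φ KL = φ K + φ L - φ KI)
    (htransl : ∀ (K K' : ConvexBody (EuclideanSpace ℝ (Fin n)))
      (x : EuclideanSpace ℝ (Fin n)),
      (K' : Set (EuclideanSpace ℝ (Fin n))) = (fun v => v + x) '' ↑K → φ K' = φ K)
    (hcont : Continuous φ)
    (hhom : ∀ (lam : ℝ), 0 ≤ lam → ∀ K, φ (lam • K) = lam ^ (n - 1) * φ K)
    (hG : ∀ g ∈ G, ∀ K K' : ConvexBody (EuclideanSpace ℝ (Fin n)),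
      (K' : Set (EuclideanSpace ℝ (Fin n))) = g '' ↑K → φ K' = φ K) : Good G (ext φ) where
  isVal := by
    refine ⟨ext_empty φ, ?_⟩
    intro A B hA hB hAB
    rcases Set.eq_empty_or_nonempty A with rfl | hAn
    · simp [ext_empty]
    rcases Set.eq_empty_or_nonempty B with rfl | hBn
    · simp [ext_empty]
    have hI : (A ∩ B).Nonempty := by
      have := isPreconnected_closed_iff.1 hAB.isPreconnected A B hA.1.isClosed hB.1.isClosed subset_rfl
        (by rw [Set.union_inter_cancel_left]; exact hAn) (by rw [Set.union_inter_cancel_right]; exact hBn)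
      exact this.mono Set.inter_subset_right
    obtain ⟨K, rfl⟩ := exists_body hA hAn
    obtain ⟨L, rfl⟩ := exists_body hB hBn
    obtain ⟨KI, hKI⟩ := exists_body (hA.inter hB) hI
    obtain ⟨KL, hKL⟩ := exists_body ⟨hA.1.union hB.1, hAB⟩ (hAn.mono Set.subset_union_left)
    rw [← hKI, ← hKL, ext_coe, ext_coe, ext_coe, ext_coe]
    exact hval K L KL KI hKL hKI
  transl := by
    intro A x hA
    rcases Set.eq_empty_or_nonempty A with rfl | hAn
    · simp
    obtain ⟨K, rfl⟩ := exists_body hA hAn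
    obtain ⟨K', hK'⟩ := exists_body (hA.translate x) (hAn.image _)
    rw [← hK', ext_coe, ext_coe]
    exact htransl K K' x hK'
  hom := by
    intro lam A hl hA
    rcases Set.eq_empty_or_nonempty A with rfl | hAn
    · simp [ext_empty]
    obtain ⟨K, rfl⟩ := exists_body hA hAn
    rw [← ConvexBody.coe_smul, ext_coe, ext_coe]
    exact hhom lam hl.le K
  inv := by
    intro g hg A hA
    rcases Set.eq_empty_or_nonempty A with rfl | hAn
    · simp
    obtain ⟨K, rfl⟩ := exists_body hA hAn
    obtain ⟨K', hK'⟩ := exists_body (hA.iso g) (hAn.image _)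
    rw [← hK', ext_coe, ext_coe]
    exact hG g hg K K' hK'
  bdd := by
    intro R
    obtain ⟨M, hM⟩ := (isCompact_bodies (n := n) R).exists_bound_of_continuousOn hcont.continuousOn
    refine ⟨max M 0, le_max_right _ _, ?_⟩
    intro A hA hAR
    rcases Set.eq_empty_or_nonempty A with rfl | hAn
    · simp [ext_empty]
    obtain ⟨K, rfl⟩ := exists_body hA hAn
    rw [ext_coe]
    exact (hM K hAR).trans (le_max_left _ _)
  unif := by
    intro R ε hε
    have hu := (isCompact_bodies (n := n) R).uniformContinuousOn_of_continuous hcont.continuousOn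
    rw [Metric.uniformContinuousOn_iff] at hu
    obtain ⟨δ, hδ, h⟩ := hu ε hε
    refine ⟨δ / 2, by linarith, ?_⟩
    intro A B hA hB hAn hBn hAR hBR hAB
    obtain ⟨K, rfl⟩ := exists_body hA hAn
    obtain ⟨L, rfl⟩ := exists_body hB hBn
    rw [ext_coe, ext_coe, ← Real.dist_eq]
    apply h K hAR L hBR
    rw [← ConvexBody.hausdorffDist_coe]
    have := Metric.hausdorffDist_le_of_mem_dist (by linarith) hAB.1 hAB.2
    linarith

end CodimOne

namespace CodimOne

variable {n : ℕ}

/-- set-valued maps with convex graph, compact values and bounded range -/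
structure CG {X : Type*} [NormedAddCommGroup X] [NormedSpace ℝ X]
    (Γ : X → Set (EuclideanSpace ℝ (Fin n))) (R : ℝ) : Prop where
  conv : ∀ y z x w, ∀ a b : ℝ, 0 ≤ a → 0 ≤ b → a + b = 1 → x ∈ Γ y → w ∈ Γ z →
    a • x + b • w ∈ Γ (a • y + b • z)
  comp : ∀ y, IsCompact (Γ y)
  bdd : ∀ y, Γ y ⊆ Metric.closedBall 0 R

lemma CG.cc {X : Type*} [NormedAddCommGroup X] [NormedSpace ℝ X]
    {Γ : X → Set (EuclideanSpace ℝ (Fin n))} {R : ℝ} (h : CG Γ R) (y : X) : CC (Γ y) := by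
  refine ⟨h.comp y, ?_⟩
  intro x hx w hw a b ha hb hab
  have := h.conv y y x w a b ha hb hab hx hw
  rwa [← add_smul, hab, one_smul] at this

lemma CG.continuousAt {X : Type*} [NormedAddCommGroup X] [NormedSpace ℝ X]
    {Γ : X → Set (EuclideanSpace ℝ (Fin n))} {R : ℝ} (h : CG Γ R)
    {G : Subgroup ((EuclideanSpace ℝ (Fin n)) ≃ₗᵢ[ℝ] (EuclideanSpace ℝ (Fin n)))}
    {F : Set (EuclideanSpace ℝ (Fin n)) → ℝ} (hF : Good G F) (y0 : X)
    (hy0 : ∀ᶠ y in nhds y0, (Γ y).Nonempty) : ContinuousAt (fun y => F (Γ y)) y0 := by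
  obtain ⟨δ, hδ, hball⟩ := Metric.eventually_nhds_iff.1 hy0
  have hR : 0 ≤ R := by
    obtain ⟨x, hx⟩ := hy0.self_of_nhds
    have := h.bdd _ hx
    rw [mem_closedBall_zero_iff] at this
    exact (norm_nonneg x).trans this
  rw [Metric.continuousAt_iff]
  intro ε hε
  obtain ⟨η, hη, hclose⟩ := hF.unif R ε hε
  set s : ℝ := min (η / (2 * R + 2)) (1 / 2) with hs
  have hs0 : 0 < s := lt_min (by positivity) (by norm_num)
  have hs1 : s ≤ 1 / 2 := min_le_right _ _
  have hsη : 2 * R * s ≤ η := by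
    have h1 : s * (2 * R + 2) ≤ η := (le_div_iff₀ (by positivity)).1 (min_le_left _ _)
    nlinarith
  have hd : ∀ x w : EuclideanSpace ℝ (Fin n), ∀ y z, x ∈ Γ y → w ∈ Γ z → ‖x - w‖ ≤ 2 * R := by
    intro x w y z hx hw
    have h1 := h.bdd _ hx
    have h2 := h.bdd _ hw
    rw [mem_closedBall_zero_iff] at h1 h2
    linarith [norm_sub_le x w]
  refine ⟨s * δ, by positivity, ?_⟩
  intro y hy
  rw [dist_eq_norm] at hy
  have hnz : ∀ t : ℝ, |t| = 1 → (Γ (y0 + (t / s) • (y - y0))).Nonempty := by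
    intro t ht
    apply hball
    rw [dist_eq_norm, add_sub_cancel_left, norm_smul, norm_div, Real.norm_eq_abs, ht,
      Real.norm_of_nonneg hs0.le]
    rw [one_div, inv_mul_lt_iff₀ hs0]
    exact hy
  rw [Real.dist_eq]
  have hyne : (Γ y).Nonempty := by
    apply hball
    rw [dist_eq_norm]
    nlinarith
  apply hclose _ _ (h.cc y) (h.cc y0) hyne hy0.self_of_nhds (h.bdd y) (h.bdd y0)
  constructor
  · intro x hx
    obtain ⟨w, hw⟩ := hnz (-1) (by simp)
    have h1 : 0 < 1 + s := by positivity
    have := h.conv _ _ x w (1 / (1 + s)) (s / (1 + s)) (by positivity) (by positivity)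
      (by field_simp) hx hw
    refine ⟨(1 / (1 + s)) • x + (s / (1 + s)) • w, ?_, ?_⟩
    · convert this using 1
      congr 1
      rw [smul_add, smul_smul, smul_sub, show s / (1 + s) * (-1 / s) = - (1 / (1 + s)) by field_simp]
      have : y0 = (1 / (1 + s)) • y0 + (s / (1 + s)) • y0 := by
        rw [← add_smul, show 1 / (1 + s) + s / (1 + s) = 1 by field_simp, one_smul]
      conv_lhs => rw [this]
      simp only [neg_smul]
      abel
    · rw [dist_eq_norm]
      have e : x - ((1 / (1 + s)) • x + (s / (1 + s)) • w) = (s / (1 + s)) • (x - w) := by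
        have : x = (1 / (1 + s)) • x + (s / (1 + s)) • x := by
          rw [← add_smul, show 1 / (1 + s) + s / (1 + s) = 1 by field_simp, one_smul]
        rw [smul_sub]
        conv_lhs => enter [1]; rw [this]
        abel
      rw [e, norm_smul, Real.norm_of_nonneg (by positivity)]
      have h2 := hd x w _ _ hx hw
      have h3 : s / (1 + s) ≤ s := div_le_self hs0.le (by linarith)
      calc s / (1 + s) * ‖x - w‖ ≤ s * (2 * R) := by gcongr
        _ ≤ η := by linarith
  · intro x hx
    obtain ⟨w, hw⟩ := hnz 1 (by simp)
    have := h.conv _ _ x w (1 - s) s (by linarith) hs0.le (by ring) hx hw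
    refine ⟨(1 - s) • x + s • w, ?_, ?_⟩
    · convert this using 1
      congr 1
      rw [smul_add, smul_smul, show s * (1 / s) = 1 by field_simp, sub_smul, one_smul, one_smul]
      abel
    · rw [dist_eq_norm]
      have e : x - ((1 - s) • x + s • w) = s • (x - w) := by
        rw [smul_sub, sub_smul, one_smul]; abel
      rw [e, norm_smul, Real.norm_of_nonneg hs0.le]
      have h2 := hd x w _ _ hx hw
      calc s * ‖x - w‖ ≤ s * (2 * R) := by gcongr
        _ ≤ η := by linarith

lemma CG.integrable {Γ : EuclideanSpace ℝ (Fin n) → Set (EuclideanSpace ℝ (Fin n))} {R : ℝ} (h : CG Γ R)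
    {G : Subgroup ((EuclideanSpace ℝ (Fin n)) ≃ₗᵢ[ℝ] (EuclideanSpace ℝ (Fin n)))}
    {F : Set (EuclideanSpace ℝ (Fin n)) → ℝ} (hF : Good G F)
    (hD : IsCompact {y | (Γ y).Nonempty}) : Integrable (fun y => F (Γ y)) := by
  set D := {y | (Γ y).Nonempty} with hDdef
  have hz : ∀ y, y ∉ D → F (Γ y) = 0 := by
    intro y hy
    have : Γ y = ∅ := Set.not_nonempty_iff_eq_empty.1 hy
    rw [this, hF.isVal.empty]
  have hDc : Convex ℝ D := by
    rintro y ⟨x, hx⟩ z ⟨w, hw⟩ a b ha hb hab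
    exact ⟨_, h.conv y z x w a b ha hb hab hx hw⟩
  have hc : ContinuousOn (fun y => F (Γ y)) (interior D) := by
    intro y hy
    apply ContinuousAt.continuousWithinAt
    apply h.continuousAt hF
    exact mem_interior_iff_mem_nhds.1 hy
  have hm : AEStronglyMeasurable (fun y => F (Γ y)) volume := by
    have h1 : AEStronglyMeasurable ((interior D).indicator (fun y => F (Γ y))) volume :=
      (aestronglyMeasurable_indicator_iff isOpen_interior.measurableSet).2
        (hc.aestronglyMeasurable isOpen_interior.measurableSet)
    refine h1.congr ?_
    have h2 : ∀ᵐ y ∂(volume : Measure (EuclideanSpace ℝ (Fin n))), y ∉ frontier D :=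
      measure_eq_zero_iff_ae_notMem.1 (hDc.addHaar_frontier volume)
    filter_upwards [h2] with y hy
    by_cases hi : y ∈ interior D
    · simp [hi]
    · rw [Set.indicator_of_notMem hi, hz y]
      intro hyD
      exact hy ⟨subset_closure hyD, hi⟩
  obtain ⟨M, hM, hb⟩ := hF.bdd R
  rw [← integrableOn_iff_integrable_of_support_subset (s := D)]
  · apply Measure.integrableOn_of_bounded hD.measure_lt_top.ne hm (M := M)
    exact Filter.Eventually.of_forall fun y => hb _ (h.cc y) (h.bdd y)
  · intro y hy
    by_contra hyD
    exact hy (hz y hyD)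

/-- intersection of a translate of `K` with `L` -/
def In (K L : Set (EuclideanSpace ℝ (Fin n))) (y : EuclideanSpace ℝ (Fin n)) : Set (EuclideanSpace ℝ (Fin n)) :=
  {x | x ∈ L ∧ x - y ∈ K}

lemma In_cg {K L : Set (EuclideanSpace ℝ (Fin n))} (hK : CC K) (hL : CC L) {R : ℝ}
    (hR : L ⊆ Metric.closedBall 0 R) : CG (In K L) R where
  conv := by
    rintro y z x w a b ha hb hab ⟨h1, h2⟩ ⟨h3, h4⟩
    refine ⟨hL.2 h1 h3 ha hb hab, ?_⟩
    have := hK.2 h2 h4 ha hb hab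
    convert this using 1
    simp only [smul_sub]; abel
  comp := fun y => hL.1.inter_right (hK.1.isClosed.preimage (by fun_prop : Continuous fun x => x - y))
  bdd := fun y x hx => hR hx.1

lemma In_integrable {K L : Set (EuclideanSpace ℝ (Fin n))} (hK : CC K) (hL : CC L)
    {G : Subgroup ((EuclideanSpace ℝ (Fin n)) ≃ₗᵢ[ℝ] (EuclideanSpace ℝ (Fin n)))}
    {F : Set (EuclideanSpace ℝ (Fin n)) → ℝ} (hF : Good G F) :
    Integrable (fun y => F (In K L y)) := by
  obtain ⟨R, hR⟩ := hL.1.isBounded.subset_closedBall 0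
  apply (In_cg hK hL hR).integrable hF
  have : {y | (In K L y).Nonempty} = L - K := by
    ext y
    rw [Set.mem_sub]
    constructor
    · rintro ⟨x, h1, h2⟩
      exact ⟨x, h1, _, h2, by abel⟩
    · rintro ⟨x, h1, z, h2, rfl⟩
      exact ⟨x, h1, by simpa using h2⟩
  rw [this, sub_eq_add_neg]
  exact hL.1.add hK.1.neg

end CodimOne

namespace CodimOne

variable {n : ℕ}

lemma shell_bound {g : EuclideanSpace ℝ (Fin n) → ℝ} {S : Set (EuclideanSpace ℝ (Fin n))} {M : ℝ}
    (hS : volume S < ⊤) (h0 : ∀ y, y ∉ S → g y = 0) (hM : ∀ y ∈ S, |g y| ≤ M) :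
    |∫ y, g y| ≤ M * (volume S).toReal := by
  rw [← setIntegral_eq_integral_of_forall_compl_eq_zero h0]
  exact norm_setIntegral_le_of_norm_le_const (f := g) (μ := volume) hS (fun y hy => hM y hy)

lemma Good.small {G : Subgroup ((EuclideanSpace ℝ (Fin n)) ≃ₗᵢ[ℝ] (EuclideanSpace ℝ (Fin n)))}
    {F : Set (EuclideanSpace ℝ (Fin n)) → ℝ} (hF : Good G F) :
    ∃ M, 0 ≤ M ∧ ∀ x r A, 0 < r → CC A → A ⊆ Metric.closedBall x r → |F A| ≤ M * r ^ (n - 1) := by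
  obtain ⟨M, hM, hb⟩ := hF.bdd 1
  refine ⟨M, hM, ?_⟩
  intro x r A hr hA hAr
  rw [← hF.transl A (-x) hA]
  set A' := (fun v => v + -x) '' A with hA'
  have hA'c : CC A' := hA.translate _
  have e : A' = r • (r⁻¹ • A') := by rw [smul_inv_smul₀ hr.ne']
  rw [e, hF.hom r _ hr (hA'c.smul _), abs_mul, abs_of_pos (pow_pos hr _), mul_comm]
  apply mul_le_mul_of_nonneg_right _ (pow_pos hr _).le
  apply hb _ (hA'c.smul _)
  rintro _ ⟨_, ⟨v, hv, rfl⟩, rfl⟩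
  have := hAr hv
  rw [Metric.mem_closedBall, dist_eq_norm] at this
  rw [mem_closedBall_zero_iff]
  simp only [norm_smul, norm_inv, Real.norm_of_nonneg hr.le, ← sub_eq_add_neg]
  rw [inv_mul_le_iff₀ hr]; simpa using this

lemma nbhd_cc {L0 : Set (EuclideanSpace ℝ (Fin n))} (hL : CC L0) (hne : L0.Nonempty) {ρ : ℝ} (hρ : 0 ≤ ρ) :
    CC {x | Metric.infDist x L0 ≤ ρ} := by
  rw [← cth_eq hne hρ]
  exact ⟨hL.1.cthickening, hL.2.cthickening ρ⟩

lemma poly_shell (P : Polynomial ℝ) (ρ : ℝ) : ∃ C, 0 ≤ C ∧ ∀ r, 0 < r → r ≤ ρ →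
    P.eval (ρ + r) - P.eval (ρ - r) ≤ C * r := by
  set Q := P.comp (Polynomial.C ρ + Polynomial.X) - P.comp (Polynomial.C ρ - Polynomial.X) with hQ
  have h0 : Q.coeff 0 = 0 := by
    rw [Polynomial.coeff_zero_eq_eval_zero, hQ]; simp [Polynomial.eval_comp]
  obtain ⟨Q1, hQ1⟩ := Polynomial.X_dvd_iff.2 h0
  obtain ⟨C, hC⟩ := (isCompact_Icc (a := (0:ℝ)) (b := ρ)).exists_bound_of_continuousOn
    (f := fun x => Q1.eval x) Q1.continuous.continuousOn
  refine ⟨max C 0, le_max_right _ _, ?_⟩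
  intro r hr hrρ
  have e : P.eval (ρ + r) - P.eval (ρ - r) = r * Q1.eval r := by
    have : Q.eval r = r * Q1.eval r := by rw [hQ1]; simp
    rw [← this, hQ]; simp [Polynomial.eval_comp]
  rw [e, mul_comm]
  have := hC r ⟨hr.le, hrρ⟩
  exact mul_le_mul_of_nonneg_right ((le_abs_self _).trans (this.trans (le_max_left _ _))) hr.le

lemma infDist_le_add {L0 : Set (EuclideanSpace ℝ (Fin n))} {z y : EuclideanSpace ℝ (Fin n)} {r : ℝ}
    (h : ‖z - y‖ ≤ r) : Metric.infDist z L0 ≤ Metric.infDist y L0 + r := by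
  have := Metric.infDist_le_infDist_add_dist (s := L0) (x := z) (y := y)
  rw [dist_eq_norm] at this
  linarith

lemma shell_vol {L0 : Set (EuclideanSpace ℝ (Fin n))} (hK : IsCompact L0) (hne : L0.Nonempty)
    {a b : ℝ} (hab : a ≤ b) :
    (volume {y | a < Metric.infDist y L0 ∧ Metric.infDist y L0 ≤ b}).toReal =
      (volume {y | Metric.infDist y L0 ≤ b}).toReal - (volume {y | Metric.infDist y L0 ≤ a}).toReal := by
  have e : {y | a < Metric.infDist y L0 ∧ Metric.infDist y L0 ≤ b} =
      {y | Metric.infDist y L0 ≤ b} \ {y | Metric.infDist y L0 ≤ a} := by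
    ext y; simp only [Set.mem_ofPred_eq, Set.mem_sdiff, not_le]; tauto
  have hs : {y | Metric.infDist y L0 ≤ a} ⊆ {y | Metric.infDist y L0 ≤ b} := fun y (hy : _ ≤ a) => hy.trans hab
  rw [e, measure_sdiff hs (isClosed_le (Metric.continuous_infDist_pt L0) continuous_const).measurableSet.nullMeasurableSet
    (volume_le_infDist_lt_top hK hne a).ne,
    ENNReal.toReal_sub_of_le (measure_mono hs) (volume_le_infDist_lt_top hK hne b).ne]

section kin

variable {G : Subgroup ((EuclideanSpace ℝ (Fin n)) ≃ₗᵢ[ℝ] (EuclideanSpace ℝ (Fin n)))}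
    {F : Set (EuclideanSpace ℝ (Fin n)) → ℝ}

lemma kin_isVal (hF : Good G F) {L : Set (EuclideanSpace ℝ (Fin n))} (hL : CC L) (v : ℝ) :
    IsVal (fun K => (∫ y, F (In K L y)) - v * F K) := by
  constructor
  · have : ∀ y, In ∅ L y = ∅ := fun y => by ext x; simp [In]
    simp [this, hF.isVal.empty]
  · intro A B hA hB hAB
    have hU : CC (A ∪ B) := ⟨hA.1.union hB.1, hAB⟩
    obtain ⟨R, hR⟩ := hL.1.isBounded.subset_closedBall 0
    have e : ∀ y, F (In (A ∪ B) L y) = F (In A L y) + F (In B L y) - F (In (A ∩ B) L y) := by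
      intro y
      have e1 : In (A ∪ B) L y = In A L y ∪ In B L y := by
        ext x; simp only [In, Set.mem_union, Set.mem_ofPred_eq]; tauto
      have e2 : In (A ∩ B) L y = In A L y ∩ In B L y := by
        ext x; simp only [In, Set.mem_inter_iff, Set.mem_ofPred_eq]; tauto
      have h1 := ((In_cg hU hL hR).cc y).2
      rw [e1] at h1 ⊢
      rw [e2]
      exact hF.isVal.val _ _ ((In_cg hA hL hR).cc y) ((In_cg hB hL hR).cc y) h1
    have iA := In_integrable hA hL hF
    have iB := In_integrable hB hL hF
    have iI := In_integrable (hA.inter hB) hL hF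
    simp only [e]
    have s1 := integral_sub (iA.add iB) iI
    have s2 := integral_add iA iB
    simp only [Pi.add_apply] at s1
    rw [s1, s2, hF.isVal.val A B hA hB hAB]
    ring

lemma kin_transl (hF : Good G F) {L : Set (EuclideanSpace ℝ (Fin n))} (v : ℝ) :
    ∀ A x, CC A → (fun K => (∫ y, F (In K L y)) - v * F K) ((fun v => v + x) '' A) =
      (fun K => (∫ y, F (In K L y)) - v * F K) A := by
  intro A x hA
  have e : ∀ y, In ((fun v => v + x) '' A) L y = In A L (y + x) := by
    intro y
    ext z
    simp only [In, Set.mem_ofPred_eq, Set.mem_image, and_congr_right_iff]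
    intro _
    constructor
    · rintro ⟨w, hw, h⟩
      convert hw using 1
      rw [sub_add_eq_sub_sub, ← h]; simp
    · intro h
      exact ⟨_, h, by abel⟩
  simp only [e]
  rw [hF.transl A x hA]
  rw [integral_add_right_eq_self (fun y => F (In A L y)) x]

lemma kin_bound (hn : 1 ≤ n) (hF : Good G F) {L0 : Set (EuclideanSpace ℝ (Fin n))} (hL0 : CC L0)
    (hne : L0.Nonempty) {ρ : ℝ} (hρ : 0 < ρ) :
    ∃ C, 0 ≤ C ∧ ∀ r, 0 < r → r ≤ ρ → ∀ A, CC A → ∀ x, A ⊆ Metric.closedBall x r →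
      |(∫ y, F (In A {x | Metric.infDist x L0 ≤ ρ} y)) -
        (volume {x | Metric.infDist x L0 ≤ ρ}).toReal * F A| ≤ C * r ^ n := by
  obtain ⟨P, hP⟩ := steiner hL0.1 hL0.2 hne
  obtain ⟨C', hC', hsh⟩ := poly_shell P ρ
  obtain ⟨M, hM, hsm⟩ := hF.small
  refine ⟨2 * M * C', by positivity, ?_⟩
  intro r hr hrρ A hA x hAx
  set L := {x | Metric.infDist x L0 ≤ ρ} with hLdef
  have hL : CC L := nbhd_cc hL0 hne hρ.le
  have htr := kin_transl hF (L := L) (volume L).toReal A (-x) hA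
  simp only at htr
  rw [← htr]
  have hK : CC ((fun v => v + -x) '' A) := hA.translate _
  have hKr : (fun v => v + -x) '' A ⊆ Metric.closedBall 0 r := by
    rintro _ ⟨v, hv, rfl⟩
    have := hAx hv
    rw [Metric.mem_closedBall, dist_eq_norm] at this
    rw [mem_closedBall_zero_iff]
    simpa [sub_eq_add_neg] using this
  generalize (fun v => v + -x) '' A = K at hK hKr
  have hi := In_integrable hK hL hF
  have hvf := hL.1.measure_lt_top (μ := volume)
  have hi2 : Integrable (L.indicator (fun _ => F K)) :=
    (integrable_indicator_iff hL.1.measurableSet).2 (integrableOn_const hvf.ne)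
  have e : (∫ y, F (In K L y)) - (volume L).toReal * F K =
      ∫ y, (F (In K L y) - L.indicator (fun _ => F K) y) := by
    rw [integral_sub hi hi2, integral_indicator hL.1.measurableSet, setIntegral_const, smul_eq_mul]
    rfl
  rw [e]
  obtain ⟨R, hR⟩ := hL.1.isBounded.subset_closedBall 0
  have hb := shell_bound (g := fun y => F (In K L y) - L.indicator (fun _ => F K) y)
    (S := {y | ρ - r < Metric.infDist y L0 ∧ Metric.infDist y L0 ≤ ρ + r}) (M := 2 * (M * r ^ (n - 1)))
    ((measure_mono (fun y hy => hy.2)).trans_lt (volume_le_infDist_lt_top hL0.1 hne (ρ + r)))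
    (by
      intro y hy
      simp only [Set.mem_ofPred_eq, not_and_or, not_lt, not_le] at hy
      rcases hy with hy | hy
      · have h1 : In K L y = (fun v => v + y) '' K := by
          ext z
          constructor
          · rintro ⟨_, h⟩; exact ⟨_, h, by simp⟩
          · rintro ⟨k, hk, rfl⟩
            refine ⟨?_, by simpa using hk⟩
            have := infDist_le_add (L0 := L0) (z := k + y) (y := y) (r := r)
              (by simpa using hKr hk)
            simp only [hLdef, Set.mem_ofPred_eq]; linarith
        have h2 : y ∈ L := by simp only [hLdef, Set.mem_ofPred_eq]; linarith
        rw [h1, hF.transl K y hK, Set.indicator_of_mem h2, sub_self]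
      · have h1 : In K L y = ∅ := by
          ext z
          simp only [Set.mem_empty_iff_false, iff_false]
          rintro ⟨h, hk⟩
          have := infDist_le_add (L0 := L0) (z := y) (y := z) (r := r)
            (by rw [norm_sub_rev]; simpa using hKr hk)
          simp only [hLdef, Set.mem_ofPred_eq] at h; linarith
        have h2 : y ∉ L := by simp only [hLdef, Set.mem_ofPred_eq]; linarith
        rw [h1, hF.isVal.empty, Set.indicator_of_notMem h2, sub_self])
    (by
      intro y _
      have h1 : |F (In K L y)| ≤ M * r ^ (n - 1) := by
        apply hsm y r _ hr ((In_cg hK hL hR).cc y)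
        rintro z ⟨_, hz⟩
        rw [Metric.mem_closedBall, dist_eq_norm]
        simpa using hKr hz
      have h2 : |L.indicator (fun _ => F K) y| ≤ M * r ^ (n - 1) := by
        by_cases hy : y ∈ L
        · rw [Set.indicator_of_mem hy]; exact hsm 0 r K hr hK hKr
        · rw [Set.indicator_of_notMem hy, abs_zero]; positivity
      refine (abs_sub _ _).trans (by linarith))
  refine hb.trans ?_
  rw [shell_vol hL0.1 hne (by linarith), hP _ (by linarith), hP _ (by linarith)]
  calc 2 * (M * r ^ (n - 1)) * (P.eval (ρ + r) - P.eval (ρ - r)) ≤ 2 * (M * r ^ (n - 1)) * (C' * r) := by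
        gcongr; exact hsh r hr hrρ
    _ = 2 * M * C' * (r ^ (n - 1) * r) := by ring
    _ = _ := by rw [← pow_succ, Nat.sub_add_cancel hn]

lemma ball_vol (R : ℝ) (hR : 0 ≤ R) : (volume (Metric.closedBall (0 : EuclideanSpace ℝ (Fin n)) R)).toReal =
    R ^ n * (volume (Metric.closedBall (0 : EuclideanSpace ℝ (Fin n)) 1)).toReal := by
  rw [Measure.addHaar_closedBall' volume 0 hR, ENNReal.toReal_mul, finrank_euclideanSpace, Fintype.card_fin,
    ENNReal.toReal_ofReal (by positivity)]

lemma ball_cc (x : EuclideanSpace ℝ (Fin n)) (r : ℝ) : CC (Metric.closedBall x r) :=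
  ⟨isCompact_closedBall _ _, convex_closedBall _ _⟩

lemma F_ball (hF : Good G F) {r : ℝ} (hr : 0 < r) :
    F (Metric.closedBall 0 r) = r ^ (n - 1) * F (Metric.closedBall 0 1) := by
  rw [← hF.hom r _ hr (ball_cc 0 1), smul_closedBall _ _ zero_le_one]
  simp [abs_of_pos hr]

lemma ball_vol_pos : 0 < (volume (Metric.closedBall (0 : EuclideanSpace ℝ (Fin n)) 1)).toReal :=
  ENNReal.toReal_pos (Metric.measure_closedBall_pos volume 0 one_pos).ne'
    (ball_cc 0 1).1.measure_lt_top.ne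

lemma kin_const (hn : 1 ≤ n) (hF : Good G F) {L : Set (EuclideanSpace ℝ (Fin n))} (hL : CC L) (hne : L.Nonempty) {v c : ℝ}
    (h : ∀ A, CC A → (∫ y, F (In A L y)) - v * F A = c * (volume A).toReal) : c = F L := by
  obtain ⟨a, ha⟩ := hL.1.isBounded.subset_closedBall 0
  have ha0 : 0 ≤ a := by
    obtain ⟨x, hx⟩ := hne
    have := ha hx
    rw [mem_closedBall_zero_iff] at this
    exact (norm_nonneg x).trans this
  obtain ⟨M, hM, hb⟩ := hF.bdd a
  set κ := (volume (Metric.closedBall (0 : EuclideanSpace ℝ (Fin n)) 1)).toReal with hκ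
  have hκ0 : 0 < κ := ball_vol_pos
  set q := |v * F (Metric.closedBall (0 : EuclideanSpace ℝ (Fin n)) 1)|
  have key : ∀ R : ℝ, a < R → 0 < R → |c - F L| * κ ≤ 2 * M * κ * ((1 + a / R) ^ n - (1 - a / R) ^ n) + q / R := by
    intro R haR hR
    set B := Metric.closedBall (0 : EuclideanSpace ℝ (Fin n)) R with hB
    have h1 := h B (ball_cc 0 R)
    rw [F_ball hF hR, ball_vol R hR.le, ← hκ] at h1
    have hi := In_integrable (ball_cc 0 R) hL hF
    have hi2 : Integrable (B.indicator (fun _ => F L)) :=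
      (integrable_indicator_iff (ball_cc 0 R).1.measurableSet).2 (integrableOn_const (ball_cc 0 R).1.measure_lt_top.ne)
    have e : (∫ y, F (In B L y)) - R ^ n * κ * F L =
        ∫ y, (F (In B L y) - B.indicator (fun _ => F L) y) := by
      rw [integral_sub hi hi2, integral_indicator (ball_cc 0 R).1.measurableSet, setIntegral_const, smul_eq_mul,
        Measure.real, hB, ball_vol R hR.le]
    have hsub : Metric.closedBall (0 : EuclideanSpace ℝ (Fin n)) (R - a) ⊆ Metric.closedBall 0 (R + a) :=
      Metric.closedBall_subset_closedBall (by linarith)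
    have hsb := shell_bound (g := fun y => F (In B L y) - B.indicator (fun _ => F L) y)
      (S := Metric.closedBall 0 (R + a) \ Metric.closedBall 0 (R - a)) (M := 2 * M)
      ((measure_mono Set.sdiff_subset).trans_lt (ball_cc 0 (R + a)).1.measure_lt_top)
      (by
        intro y hy
        rw [Set.mem_sdiff, not_and_or, not_not, mem_closedBall_zero_iff, mem_closedBall_zero_iff, not_le] at hy
        rcases hy with hy | hy
        · have h1 : In B L y = ∅ := by
            ext z
            simp only [Set.mem_empty_iff_false, iff_false]
            rintro ⟨h, hk⟩
            have h3 := ha h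
            rw [hB, mem_closedBall_zero_iff, norm_sub_rev] at hk
            rw [mem_closedBall_zero_iff] at h3
            linarith [norm_sub_norm_le y z]
          have h2 : y ∉ B := by rw [hB, mem_closedBall_zero_iff]; linarith
          rw [h1, hF.isVal.empty, Set.indicator_of_notMem h2, sub_self]
        · have h1 : In B L y = L := by
            ext z
            constructor
            · rintro ⟨h, _⟩; exact h
            · intro h
              refine ⟨h, ?_⟩
              have h3 := ha h
              rw [mem_closedBall_zero_iff] at h3
              rw [hB, mem_closedBall_zero_iff]
              linarith [norm_sub_le z y]
          have h2 : y ∈ B := by rw [hB, mem_closedBall_zero_iff]; linarith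
          rw [h1, Set.indicator_of_mem h2, sub_self])
      (by
        intro y _
        have h1 : |F (In B L y)| ≤ M :=
          hb _ ((In_cg (ball_cc 0 R) hL ha).cc y) (fun z hz => ha hz.1)
        have h2 : |B.indicator (fun _ => F L) y| ≤ M := by
          by_cases hy : y ∈ B
          · rw [Set.indicator_of_mem hy]; exact hb L hL ha
          · rw [Set.indicator_of_notMem hy, abs_zero]; exact hM
        refine (abs_sub _ _).trans (by linarith))
    rw [← e, measure_sdiff hsub (ball_cc 0 (R - a)).1.measurableSet.nullMeasurableSet
      (ball_cc 0 (R - a)).1.measure_lt_top.ne, ENNReal.toReal_sub_of_le (measure_mono hsub)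
      (ball_cc 0 (R + a)).1.measure_lt_top.ne, ball_vol (R + a) (by linarith), ball_vol (R - a) (by linarith), ← hκ] at hsb
    set J := ∫ y, F (In B L y)
    have h3 : (c - F L) * κ * R ^ n = (J - R ^ n * κ * F L) - v * F (Metric.closedBall 0 1) * R ^ (n - 1) := by
      linarith
    have h4 : |c - F L| * κ * R ^ n ≤ 2 * M * ((R + a) ^ n * κ - (R - a) ^ n * κ) + q * R ^ (n - 1) := by
      have : |(c - F L) * κ * R ^ n| = |c - F L| * κ * R ^ n := by
        rw [abs_mul, abs_mul, abs_of_pos hκ0, abs_of_pos (pow_pos hR n)]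
      rw [← this, h3]
      refine (abs_sub _ _).trans ?_
      rw [abs_mul _ (R ^ (n - 1)), abs_of_pos (pow_pos hR (n - 1))]
      gcongr
    have h5 : (1 + a / R) = (R + a) / R := by field_simp
    have h6 : (1 - a / R) = (R - a) / R := by field_simp
    have h7 : R ^ n = R ^ (n - 1) * R := by rw [← pow_succ, Nat.sub_add_cancel hn]
    rw [h5, h6, div_pow, div_pow]
    have h8 : 2 * M * κ * ((R + a) ^ n / R ^ n - (R - a) ^ n / R ^ n) + q / R =
      (2 * M * ((R + a) ^ n * κ - (R - a) ^ n * κ) + q * R ^ (n - 1)) / R ^ n := by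
      rw [add_div]
      congr 1
      · ring
      · rw [h7]; field_simp
    rw [h8, le_div_iff₀ (pow_pos hR n)]
    exact h4
  have hlim0 : Filter.Tendsto (fun R : ℝ => a / R) Filter.atTop (nhds 0) :=
    Filter.Tendsto.div_atTop tendsto_const_nhds Filter.tendsto_id
  have hlimq : Filter.Tendsto (fun R : ℝ => q / R) Filter.atTop (nhds 0) :=
    Filter.Tendsto.div_atTop tendsto_const_nhds Filter.tendsto_id
  have hlim : Filter.Tendsto (fun R : ℝ => 2 * M * κ * ((1 + a / R) ^ n - (1 - a / R) ^ n) + q / R)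
      Filter.atTop (nhds (2 * M * κ * ((1 + 0) ^ n - (1 - 0) ^ n) + 0)) :=
    ((((hlim0.const_add 1).pow n).sub ((hlim0.const_sub 1).pow n)).const_mul _).add hlimq
  have h9 : |c - F L| * κ ≤ 0 := by
    have := ge_of_tendsto hlim (by
      filter_upwards [Filter.eventually_gt_atTop a, Filter.eventually_gt_atTop 0] with R h1 h2
      exact key R h1 h2)
    simpa using this
  have h10 : |c - F L| ≤ 0 := by
    by_contra hcon
    push Not at hcon
    nlinarith [mul_pos hcon hκ0]
  linarith [abs_nonpos_iff.1 h10]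

theorem kin (hn : 1 ≤ n) (hF : Good G F) {L0 : Set (EuclideanSpace ℝ (Fin n))} (hL0 : CC L0)
    (hne : L0.Nonempty) {ρ : ℝ} (hρ : 0 < ρ) (A : Set (EuclideanSpace ℝ (Fin n))) (hA : CC A) :
    (∫ y, F (In A {x | Metric.infDist x L0 ≤ ρ} y)) -
        (volume {x | Metric.infDist x L0 ≤ ρ}).toReal * F A =
      F {x | Metric.infDist x L0 ≤ ρ} * (volume A).toReal := by
  obtain ⟨C, hC, hb⟩ := kin_bound hn hF hL0 hne hρ
  have hL := nbhd_cc hL0 hne hρ.le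
  obtain ⟨c, hc⟩ := lemmaG (kin_isVal hF hL (volume {x | Metric.infDist x L0 ≤ ρ}).toReal) hC hρ
    (kin_transl hF _) hb
  have hneL : {x | Metric.infDist x L0 ≤ ρ}.Nonempty := by
    obtain ⟨x, hx⟩ := hne
    exact ⟨x, by rw [Set.mem_ofPred_eq, Metric.infDist_zero_of_mem hx]; exact hρ.le⟩
  have := kin_const hn hF hL hneL hc
  rw [← this]
  exact hc A hA

end kin

end CodimOne

namespace CodimOne

variable {n : ℕ}

/-- spherical cap-like slices of the unit ball -/
def cap (u : EuclideanSpace ℝ (Fin n)) (t : ℝ) : Set (EuclideanSpace ℝ (Fin n)) :=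
  {z | ‖z‖ ≤ 1 ∧ inner ℝ z u ≤ t}

lemma cap_cg (u : EuclideanSpace ℝ (Fin n)) : CG (cap u) 1 where
  conv := by
    rintro s t x w a b ha hb hab ⟨h1, h2⟩ ⟨h3, h4⟩
    constructor
    · refine (norm_add_le _ _).trans ?_
      rw [norm_smul, norm_smul, Real.norm_of_nonneg ha, Real.norm_of_nonneg hb]
      nlinarith
    · rw [inner_add_left, real_inner_smul_left, real_inner_smul_left]
      simp only [smul_eq_mul]
      gcongr
  comp := by
    intro t
    have : cap u t = Metric.closedBall 0 1 ∩ {z | inner ℝ z u ≤ t} := by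
      ext z; simp [cap]
    rw [this]
    exact (isCompact_closedBall _ _).inter_right (isClosed_le (by fun_prop) continuous_const)
  bdd := by
    intro t z hz
    simpa using hz.1

lemma cap_nonempty {u : EuclideanSpace ℝ (Fin n)} (hu : ‖u‖ = 1) {t : ℝ} (ht : -1 ≤ t) : (cap u t).Nonempty :=
  ⟨-u, by rw [norm_neg, hu], by rw [inner_neg_left, real_inner_self_eq_norm_sq, hu]; linarith⟩

lemma cap_empty {u : EuclideanSpace ℝ (Fin n)} (hu : ‖u‖ = 1) {t : ℝ} (ht : t < -1) : cap u t = ∅ := by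
  ext z
  simp only [Set.mem_empty_iff_false, iff_false]
  rintro ⟨h1, h2⟩
  have := abs_le.1 (abs_real_inner_le_norm z u)
  rw [hu, mul_one] at this
  linarith [this.1]

lemma cap_full {u : EuclideanSpace ℝ (Fin n)} (hu : ‖u‖ = 1) {t : ℝ} (ht : 1 ≤ t) :
    cap u t = Metric.closedBall 0 1 := by
  ext z
  rw [mem_closedBall_zero_iff]
  constructor
  · exact fun h => h.1
  · intro h
    have := abs_le.1 (abs_real_inner_le_norm z u)
    rw [hu, mul_one] at this
    exact ⟨h, by linarith [this.2]⟩

section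
variable {G : Subgroup ((EuclideanSpace ℝ (Fin n)) ≃ₗᵢ[ℝ] (EuclideanSpace ℝ (Fin n)))}
    {F : Set (EuclideanSpace ℝ (Fin n)) → ℝ}

lemma cap_inv (hF : Good G F) (htrans : ∀ x y : EuclideanSpace ℝ (Fin n), ‖x‖ = 1 → ‖y‖ = 1 →
      ∃ g ∈ G, g x = y) {u v : EuclideanSpace ℝ (Fin n)} (hu : ‖u‖ = 1) (hv : ‖v‖ = 1) (t : ℝ) :
    F (cap u t) = F (cap v t) := by
  obtain ⟨g, hg, rfl⟩ := htrans u v hu hv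
  rw [← hF.inv g hg _ ((cap_cg u).cc t)]
  congr 1
  ext z
  constructor
  · rintro ⟨w, ⟨h1, h2⟩, rfl⟩
    exact ⟨by rw [g.norm_map]; exact h1, by rw [g.inner_map_map]; exact h2⟩
  · rintro ⟨h1, h2⟩
    refine ⟨g.symm z, ⟨by rw [g.symm.norm_map]; exact h1, ?_⟩, by simp⟩
    rw [← g.inner_map_map]; simpa using h2

/-- the profile function -/
noncomputable def prof (F : Set (EuclideanSpace ℝ (Fin n)) → ℝ) (u : EuclideanSpace ℝ (Fin n)) (t : ℝ) : ℝ :=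
  F (cap u t) - (Set.Ici (0:ℝ)).indicator (fun _ => F (Metric.closedBall 0 1)) t

lemma prof_zero (hF : Good G F) {u : EuclideanSpace ℝ (Fin n)} (hu : ‖u‖ = 1) {t : ℝ} (ht : t < -1 ∨ 1 ≤ t) :
    prof F u t = 0 := by
  unfold prof
  rcases ht with ht | ht
  · rw [cap_empty hu ht, hF.isVal.empty, Set.indicator_of_notMem (by simp; linarith), sub_self]
  · rw [cap_full hu ht, Set.indicator_of_mem (by simp; linarith), sub_self]

lemma prof_bdd (hF : Good G F) (u : EuclideanSpace ℝ (Fin n)) : ∃ M, ∀ t, |prof F u t| ≤ M := by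
  obtain ⟨M, hM, hb⟩ := hF.bdd 1
  refine ⟨M + M, fun t => (abs_sub _ _).trans (add_le_add (hb _ ((cap_cg u).cc t) ((cap_cg u).bdd t)) ?_)⟩
  by_cases ht : t ∈ Set.Ici (0:ℝ)
  · rw [Set.indicator_of_mem ht]; exact hb _ (ball_cc 0 1) subset_rfl
  · rw [Set.indicator_of_notMem ht, abs_zero]; exact hM

lemma prof_meas (hF : Good G F) {u : EuclideanSpace ℝ (Fin n)} (hu : ‖u‖ = 1) : Measurable (prof F u) := by
  apply Measurable.sub
  · classical
    have hc : ContinuousOn (fun t => F (cap u t)) (Set.Ioi (-1)) := by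
      intro t ht
      apply ContinuousAt.continuousWithinAt
      apply (cap_cg u).continuousAt hF
      filter_upwards [Ioi_mem_nhds (show (-1 : ℝ) < t from ht)] with s hs
      exact cap_nonempty hu (le_of_lt hs)
    have h1 := hc.measurable_piecewise (g := fun _ => (0 : ℝ)) continuousOn_const measurableSet_Ioi
    have h2 : Measurable (({-1} : Set ℝ).indicator (fun _ => F (cap u (-1)))) :=
      measurable_const.indicator (measurableSet_singleton _)
    have e : (fun t => F (cap u t)) = (Set.Ioi (-1 : ℝ)).piecewise (fun t => F (cap u t)) (fun _ => (0 : ℝ)) +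
        ({-1} : Set ℝ).indicator (fun _ => F (cap u (-1))) := by
      funext t
      rw [Pi.add_apply]
      by_cases h1 : t ∈ Set.Ioi (-1:ℝ)
      · have h3 : t ∉ ({-1} : Set ℝ) := by
          intro h
          rw [Set.mem_singleton_iff] at h
          rw [Set.mem_Ioi] at h1
          linarith
        rw [Set.piecewise_eq_of_mem _ _ _ h1, Set.indicator_of_notMem h3, add_zero]
      · rw [Set.piecewise_eq_of_notMem _ _ _ h1, zero_add]
        by_cases h2 : t = -1
        · rw [h2, Set.indicator_of_mem (Set.mem_singleton _)]
        · rw [Set.indicator_of_notMem (by simpa using h2), cap_empty hu, hF.isVal.empty]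
          simp at h1
          exact lt_of_le_of_ne h1 h2
    rw [e]
    exact h1.add h2
  · exact measurable_const.indicator measurableSet_Ici

lemma M_close {L0 : Set (EuclideanSpace ℝ (Fin n))} (hL0 : CC L0)
    (hne : L0.Nonempty) {ρ r : ℝ} (hρ : 0 < ρ) (hr : 0 < r) (hrρ : 2 * r ≤ ρ) (y : EuclideanSpace ℝ (Fin n))
    (hy1 : ρ - r < Metric.infDist y L0) (hy2 : Metric.infDist y L0 ≤ ρ + r) :
    ∃ u : EuclideanSpace ℝ (Fin n), ‖u‖ = 1 ∧
      {z | ‖z‖ ≤ 1 ∧ Metric.infDist (y + r • z) L0 ≤ ρ}.Nonempty ∧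
      Close (2 * r / ρ) {z | ‖z‖ ≤ 1 ∧ Metric.infDist (y + r • z) L0 ≤ ρ}
        (cap u ((ρ - Metric.infDist y L0) / r)) := by
  obtain ⟨p, hp, hi⟩ := exists_proj L0 hL0.1 hL0.2 hne
  set d := Metric.infDist y L0 with hd
  have hd0 : 0 < d := by linarith
  have hdp : d = ‖y - p y‖ := proj_infDist hp hi y
  obtain ⟨u, hu⟩ : ∃ u, u = d⁻¹ • (y - p y) := ⟨_, rfl⟩
  have hdu : y - p y = d • u := by rw [hu, smul_inv_smul₀ hd0.ne']
  have hu1 : ‖u‖ = 1 := by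
    rw [hu, norm_smul, ← hdp, norm_inv, Real.norm_of_nonneg hd0.le, inv_mul_cancel₀ hd0.ne']
  set t := (ρ - d) / r with ht
  have hrt : r * t = ρ - d := by rw [ht]; field_simp
  have ht1 : -1 ≤ t := by rw [ht, le_div_iff₀ hr]; linarith
  have ht2 : t ≤ 1 := by rw [ht, div_le_iff₀ hr]; linarith
  have hclose2 : ∀ x ∈ cap u t, ∃ z ∈ {z | ‖z‖ ≤ 1 ∧ Metric.infDist (y + r • z) L0 ≤ ρ},
      dist x z ≤ 2 * r / ρ := by
    rintro x ⟨hx1, hx2⟩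
    set s := r / ρ with hs
    have hs0 : 0 < s := by positivity
    have hs1 : s ≤ 1 / 2 := by rw [hs, div_le_iff₀ hρ]; linarith
    have hsρ : s * ρ = r := by rw [hs]; field_simp
    refine ⟨(1 - s) • x - s • u, ⟨?_, ?_⟩, ?_⟩
    · refine (norm_sub_le _ _).trans ?_
      rw [norm_smul, norm_smul, hu1, Real.norm_of_nonneg hs0.le, Real.norm_of_nonneg (by linarith)]
      nlinarith
    · have h1 : Metric.infDist (y + r • ((1 - s) • x - s • u)) L0 ≤ ‖y + r • ((1 - s) • x - s • u) - p y‖ := by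
        rw [← dist_eq_norm]; exact Metric.infDist_le_dist_of_mem (hp y)
      refine h1.trans ?_
      have e : y + r • ((1 - s) • x - s • u) - p y = (d - r * s) • u + (r * (1 - s)) • x := by
        rw [add_sub_right_comm, hdu, smul_sub, smul_smul, smul_smul, sub_smul]; abel
      rw [e]
      apply abs_le_of_sq_le_sq' _ hρ.le |>.2
      rw [norm_add_sq_real, norm_smul, norm_smul, hu1, real_inner_smul_left, real_inner_smul_right,
        Real.norm_of_nonneg (show 0 ≤ r * (1 - s) by apply mul_nonneg hr.le; linarith)]
      rw [real_inner_comm] at hx2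
      have hds : 0 ≤ d - r * s := by nlinarith
      rw [Real.norm_of_nonneg hds]
      have hx3 : ‖x‖ ^ 2 ≤ 1 := by
        have := norm_nonneg x; nlinarith
      have hA : (d - r * s) * (r * (1 - s) * inner ℝ u x) ≤ (d - r * s) * (r * (1 - s) * t) := by
        apply mul_le_mul_of_nonneg_left _ hds
        apply mul_le_mul_of_nonneg_left hx2
        apply mul_nonneg hr.le; linarith
      have hB : (r * (1 - s) * ‖x‖) ^ 2 ≤ (r * (1 - s)) ^ 2 := by
        rw [mul_pow]; nlinarith [sq_nonneg (r * (1 - s))]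
      have hd' : d = ρ - r * t := by linarith
      have hC : s ^ 2 * (1 + t) + (1 - s) ^ 2 * (1 - t) ≤ 2 := by nlinarith
      have hD : ((d - r * s) * 1) ^ 2 + 2 * ((d - r * s) * (r * (1 - s) * t)) + (r * (1 - s)) ^ 2 =
          ρ ^ 2 - 2 * r * (s * ρ) * (1 + t) + r ^ 2 * (1 + t) * (s ^ 2 * (1 + t) + (1 - s) ^ 2 * (1 - t)) := by
        rw [hd']; ring
      have hE : r ^ 2 * (1 + t) * (s ^ 2 * (1 + t) + (1 - s) ^ 2 * (1 - t)) ≤ r ^ 2 * (1 + t) * 2 := by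
        apply mul_le_mul_of_nonneg_left hC
        apply mul_nonneg (sq_nonneg r); linarith
      rw [hsρ] at hD
      nlinarith
    · rw [dist_eq_norm]
      have e : x - ((1 - s) • x - s • u) = s • (x + u) := by
        rw [smul_add, sub_smul, one_smul]; abel
      rw [e, norm_smul, Real.norm_of_nonneg hs0.le]
      have := norm_add_le x u
      have h3 : 2 * r / ρ = s * 2 := by rw [hs]; ring
      rw [h3]
      apply mul_le_mul_of_nonneg_left _ hs0.le
      linarith
  refine ⟨u, hu1, ?_, ?_, hclose2⟩
  · obtain ⟨x, hx⟩ := cap_nonempty hu1 ht1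
    obtain ⟨z, hz, _⟩ := hclose2 x hx
    exact ⟨z, hz⟩
  · rintro z ⟨hz1, hz2⟩
    refine ⟨z, ⟨hz1, ?_⟩, by rw [dist_self]; positivity⟩
    rw [proj_infDist hp hi] at hz2
    set w := p (y + r • z) with hw
    have h1 := hi y w (hp _)
    rw [hdu, real_inner_smul_left] at h1
    have h2 : inner ℝ u (w - p y) ≤ 0 := by
      by_contra hcon
      push Not at hcon
      nlinarith [mul_pos hd0 hcon]
    have h3 : inner ℝ u (y + r • z - w) ≤ ρ := by
      have := (abs_le.1 (abs_real_inner_le_norm u (y + r • z - w))).2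
      rw [hu1, one_mul] at this
      linarith
    have e : y + r • z - w = d • u + r • z - (w - p y) := by rw [← hdu]; abel
    rw [e, inner_sub_right, inner_add_right, real_inner_smul_right, real_inner_smul_right,
      real_inner_self_eq_norm_sq, hu1, real_inner_comm] at h3
    rw [ht, le_div_iff₀ hr]
    linarith

end
end CodimOne

namespace CodimOne

variable {n : ℕ}
section
variable {G : Subgroup ((EuclideanSpace ℝ (Fin n)) ≃ₗᵢ[ℝ] (EuclideanSpace ℝ (Fin n)))}
    {F : Set (EuclideanSpace ℝ (Fin n)) → ℝ}

lemma M_cc {L0 : Set (EuclideanSpace ℝ (Fin n))} (hL0 : CC L0) (hne : L0.Nonempty) {ρ r : ℝ} (hρ : 0 < ρ)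
    (y : EuclideanSpace ℝ (Fin n)) : CC {z | ‖z‖ ≤ 1 ∧ Metric.infDist (y + r • z) L0 ≤ ρ} := by
  have e : {z | ‖z‖ ≤ 1 ∧ Metric.infDist (y + r • z) L0 ≤ ρ} =
      Metric.closedBall 0 1 ∩ {z | Metric.infDist (y + r • z) L0 ≤ ρ} := by
    ext z; simp
  rw [e]
  constructor
  · refine (isCompact_closedBall _ _).inter_right (isClosed_le ?_ continuous_const)
    exact (Metric.continuous_infDist_pt L0).comp (by fun_prop)
  · refine (convex_closedBall _ _).inter ?_
    intro z hz w hw a b ha hb hab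
    have := (nbhd_cc hL0 hne hρ.le).2 hz hw ha hb hab
    rw [Set.mem_ofPred_eq] at this ⊢
    convert this using 2
    simp only [smul_add]
    have h1 : a • y + r • 0 + b • y = y := by rw [smul_zero, add_zero, ← add_smul, hab, one_smul]
    rw [smul_comm a r, smul_comm b r]
    calc y + (r • a • z + r • b • w) = (a • y + r • 0 + b • y) + (r • a • z + r • b • w) := by rw [h1]
      _ = _ := by rw [smul_zero]; abel

lemma F_In_ball (hF : Good G F) {L0 : Set (EuclideanSpace ℝ (Fin n))} (hL0 : CC L0) (hne : L0.Nonempty)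
    {ρ r : ℝ} (hρ : 0 < ρ) (hr : 0 < r) (y : EuclideanSpace ℝ (Fin n)) :
    F (In (Metric.closedBall 0 r) {x | Metric.infDist x L0 ≤ ρ} y) =
      r ^ (n - 1) * F {z | ‖z‖ ≤ 1 ∧ Metric.infDist (y + r • z) L0 ≤ ρ} := by
  have hM := M_cc (r := r) hL0 hne hρ y
  rw [← hF.hom r _ hr hM, ← hF.transl _ y (hM.smul r)]
  congr 1
  ext x
  constructor
  · rintro ⟨h1, h2⟩
    rw [mem_closedBall_zero_iff] at h2
    refine ⟨x - y, ⟨r⁻¹ • (x - y), ⟨?_, ?_⟩, smul_inv_smul₀ hr.ne' _⟩, sub_add_cancel _ _⟩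
    · rw [norm_smul, norm_inv, Real.norm_of_nonneg hr.le, inv_mul_le_iff₀ hr, mul_one]; exact h2
    · rw [smul_inv_smul₀ hr.ne', add_sub_cancel]; exact h1
  · rintro ⟨w, ⟨z, ⟨h1, h2⟩, rfl⟩, rfl⟩
    refine ⟨?_, ?_⟩
    · rw [Set.mem_ofPred_eq]
      simpa [add_comm] using h2
    · rw [mem_closedBall_zero_iff]
      simp only [add_sub_cancel_right, norm_smul, Real.norm_of_nonneg hr.le]
      nlinarith

lemma prof_integrable (hF : Good G F) {u : EuclideanSpace ℝ (Fin n)} (hu : ‖u‖ = 1)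
    {L0 : Set (EuclideanSpace ℝ (Fin n))} (hL0 : CC L0) (hne : L0.Nonempty) {ρ r : ℝ} (hr : 0 < r) :
    Integrable (fun y => prof F u ((ρ - Metric.infDist y L0) / r)) := by
  obtain ⟨M, hM⟩ := prof_bdd hF u
  have hm : Measurable (fun y => prof F u ((ρ - Metric.infDist y L0) / r)) :=
    (prof_meas hF hu).comp (by
      have := (Metric.continuous_infDist_pt L0).measurable
      fun_prop)
  have hms : MeasurableSet {y | Metric.infDist y L0 ≤ ρ + r} :=
    (isClosed_le (Metric.continuous_infDist_pt L0) continuous_const).measurableSet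
  have hi : IntegrableOn (fun y => prof F u ((ρ - Metric.infDist y L0) / r)) {y | Metric.infDist y L0 ≤ ρ + r} := by
    refine Measure.integrableOn_of_bounded (M := M) (volume_le_infDist_lt_top hL0.1 hne _).ne hm.aestronglyMeasurable ?_
    exact Filter.Eventually.of_forall fun y => hM _
  refine hi.integrable_of_forall_notMem_eq_zero ?_
  intro y hy
  rw [Set.mem_ofPred_eq, not_le] at hy
  refine prof_zero hF hu (Or.inl ?_)
  rw [div_lt_iff₀ hr]; linarith

lemma asymp (hn : 1 ≤ n) (hF : Good G F)
    (htrans : ∀ x y : EuclideanSpace ℝ (Fin n), ‖x‖ = 1 → ‖y‖ = 1 → ∃ g ∈ G, g x = y)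
    {u : EuclideanSpace ℝ (Fin n)} (hu : ‖u‖ = 1)
    {L0 : Set (EuclideanSpace ℝ (Fin n))} (hL0 : CC L0) (hne : L0.Nonempty) {ρ : ℝ} (hρ : 0 < ρ) :
    Filter.Tendsto (fun r => r⁻¹ * ∫ y, prof F u ((ρ - Metric.infDist y L0) / r)) (nhdsWithin 0 (Set.Ioi 0))
      (nhds (F {x | Metric.infDist x L0 ≤ ρ} *
        (volume (Metric.closedBall (0 : EuclideanSpace ℝ (Fin n)) 1)).toReal)) := by
  obtain ⟨P, hP⟩ := steiner hL0.1 hL0.2 hne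
  obtain ⟨C, hC, hsh⟩ := poly_shell P ρ
  rw [Metric.tendsto_nhds]
  intro η hη
  obtain ⟨δ, hδ, hun⟩ := hF.unif 1 (η / (C + 1)) (by positivity)
  have hev : ∀ᶠ r in nhdsWithin (0:ℝ) (Set.Ioi 0), r < min (ρ / 2) (δ * ρ / 2) :=
    Filter.Eventually.filter_mono nhdsWithin_le_nhds (Iio_mem_nhds (by positivity))
  filter_upwards [hev, self_mem_nhdsWithin] with r hr1 hr
  rw [Set.mem_Ioi] at hr
  have hrρ : r < ρ / 2 := hr1.trans_le (min_le_left _ _)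
  have hrδ : r < δ * ρ / 2 := hr1.trans_le (min_le_right _ _)
  set L := {x | Metric.infDist x L0 ≤ ρ} with hLdef
  set κ := (volume (Metric.closedBall (0 : EuclideanSpace ℝ (Fin n)) 1)).toReal
  have hLcc : CC L := nbhd_cc hL0 hne hρ.le
  have hk := kin hn hF hL0 hne hρ _ (ball_cc 0 r)
  rw [← hLdef, ball_vol r hr.le] at hk
  have hi := In_integrable (ball_cc 0 r) hLcc hF
  have hi2 : Integrable (L.indicator (fun _ => F (Metric.closedBall 0 r))) :=
    (integrable_indicator_iff hLcc.1.measurableSet).2 (integrableOn_const hLcc.1.measure_lt_top.ne)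
  have hi3 := (prof_integrable (ρ := ρ) hF hu hL0 hne hr).const_mul (r ^ (n - 1))
  have e : (∫ y, F (In (Metric.closedBall 0 r) L y)) - (volume L).toReal * F (Metric.closedBall 0 r)
      - r ^ (n - 1) * (∫ y, prof F u ((ρ - Metric.infDist y L0) / r)) =
      ∫ y, (F (In (Metric.closedBall 0 r) L y) - L.indicator (fun _ => F (Metric.closedBall 0 r)) y
        - r ^ (n - 1) * prof F u ((ρ - Metric.infDist y L0) / r)) := by
    have hi4 : Integrable (fun y => F (In (Metric.closedBall 0 r) L y) - L.indicator (fun _ => F (Metric.closedBall 0 r)) y) :=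
      hi.sub hi2
    rw [integral_sub hi4 hi3, integral_sub hi hi2, integral_indicator hLcc.1.measurableSet,
      setIntegral_const, smul_eq_mul, Measure.real, integral_const_mul]
  have hind : ∀ y, L.indicator (fun _ => F (Metric.closedBall 0 r)) y =
      r ^ (n - 1) * (Set.Ici (0:ℝ)).indicator (fun _ => F (Metric.closedBall 0 1)) ((ρ - Metric.infDist y L0) / r) := by
    intro y
    have hiff : (ρ - Metric.infDist y L0) / r ∈ Set.Ici (0:ℝ) ↔ y ∈ L := by
      rw [Set.mem_Ici, le_div_iff₀ hr, zero_mul, sub_nonneg]; rfl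
    by_cases hy : y ∈ L
    · rw [Set.indicator_of_mem hy, Set.indicator_of_mem (hiff.2 hy), F_ball hF hr]
    · rw [Set.indicator_of_notMem hy, Set.indicator_of_notMem (fun h => hy (hiff.1 h)), mul_zero]
  have hpt : ∀ y, F (In (Metric.closedBall 0 r) L y) - L.indicator (fun _ => F (Metric.closedBall 0 r)) y
        - r ^ (n - 1) * prof F u ((ρ - Metric.infDist y L0) / r) =
      r ^ (n - 1) * (F {z | ‖z‖ ≤ 1 ∧ Metric.infDist (y + r • z) L0 ≤ ρ} -
        F (cap u ((ρ - Metric.infDist y L0) / r))) := by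
    intro y
    rw [hind, F_In_ball hF hL0 hne hρ hr]
    unfold prof
    ring
  have hsb := shell_bound (g := fun y => F (In (Metric.closedBall 0 r) L y) - L.indicator (fun _ => F (Metric.closedBall 0 r)) y
        - r ^ (n - 1) * prof F u ((ρ - Metric.infDist y L0) / r))
      (S := {y | ρ - r < Metric.infDist y L0 ∧ Metric.infDist y L0 ≤ ρ + r}) (M := r ^ (n - 1) * (η / (C + 1)))
      ((measure_mono (fun y hy => hy.2)).trans_lt (volume_le_infDist_lt_top hL0.1 hne (ρ + r)))
      (by
        intro y hy
        rw [hpt]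
        rw [Set.mem_ofPred_eq, not_and_or, not_lt, not_le] at hy
        rcases hy with hy | hy
        · rw [cap_full hu (by rw [le_div_iff₀ hr]; linarith)]
          have : {z | ‖z‖ ≤ 1 ∧ Metric.infDist (y + r • z) L0 ≤ ρ} = Metric.closedBall 0 1 := by
            ext z
            rw [mem_closedBall_zero_iff]
            refine ⟨fun h => h.1, fun h => ⟨h, ?_⟩⟩
            have := infDist_le_add (L0 := L0) (z := y + r • z) (y := y) (r := r) (by
              rw [add_sub_cancel_left, norm_smul, Real.norm_of_nonneg hr.le]; nlinarith)
            linarith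
          rw [this, sub_self, mul_zero]
        · rw [cap_empty hu (by rw [div_lt_iff₀ hr]; linarith)]
          have : {z | ‖z‖ ≤ 1 ∧ Metric.infDist (y + r • z) L0 ≤ ρ} = ∅ := by
            ext z
            simp only [Set.mem_empty_iff_false, iff_false]
            rintro ⟨h, h2⟩
            have := infDist_le_add (L0 := L0) (z := y) (y := y + r • z) (r := r) (by
              rw [sub_add_cancel_left, norm_neg, norm_smul, Real.norm_of_nonneg hr.le]; nlinarith)
            linarith
          rw [this, sub_self, mul_zero])
      (by
        rintro y ⟨hy1, hy2⟩
        rw [hpt, abs_mul, abs_of_pos (pow_pos hr (n - 1))]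
        obtain ⟨v, hv, hMne, hcl⟩ := M_close hL0 hne hρ hr (by linarith) y hy1 hy2
        rw [cap_inv hF htrans hu hv]
        refine mul_le_mul_of_nonneg_left (le_of_lt ?_) (by positivity)
        have hle : 2 * r / ρ ≤ δ := by rw [div_le_iff₀ hρ]; linarith
        refine hun _ _ (M_cc hL0 hne hρ y) ((cap_cg v).cc _) hMne
          (cap_nonempty hv (by rw [le_div_iff₀ hr]; linarith)) ?_ ((cap_cg v).bdd _) ?_
        · intro z hz; rw [mem_closedBall_zero_iff]; exact hz.1
        · exact ⟨fun x hx => let ⟨w, hw, h⟩ := hcl.1 x hx; ⟨w, hw, h.trans hle⟩,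
            fun x hx => let ⟨w, hw, h⟩ := hcl.2 x hx; ⟨w, hw, h.trans hle⟩⟩)
  rw [← e, hk, shell_vol hL0.1 hne (by linarith), hP _ (by linarith), hP _ (by linarith)] at hsb
  set I := ∫ y, prof F u ((ρ - Metric.infDist y L0) / r)
  have h7 : r ^ n = r ^ (n - 1) * r := by rw [← pow_succ, Nat.sub_add_cancel hn]
  have hpos : 0 < r ^ (n - 1) * r := by positivity
  have h8 : F L * (r ^ n * κ) - r ^ (n - 1) * I = (r ^ (n - 1) * r) * (F L * κ - r⁻¹ * I) := by
    rw [h7]; field_simp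
  rw [h8, abs_mul, abs_of_pos hpos] at hsb
  have h9 : r ^ (n - 1) * (η / (C + 1)) * (P.eval (ρ + r) - P.eval (ρ - r)) ≤
      (r ^ (n - 1) * r) * (η / (C + 1) * C) := by
    calc _ ≤ r ^ (n - 1) * (η / (C + 1)) * (C * r) := by
          gcongr; exact hsh r hr (by linarith)
      _ = _ := by ring
  have h10 := le_of_mul_le_mul_left (hsb.trans h9) hpos
  rw [Real.dist_eq, abs_sub_comm]
  refine h10.trans_lt ?_
  rw [div_mul_eq_mul_div, div_lt_iff₀ (by positivity)]
  linarith

end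
end CodimOne

namespace CodimOne

variable {n : ℕ}
section
variable {G : Subgroup ((EuclideanSpace ℝ (Fin n)) ≃ₗᵢ[ℝ] (EuclideanSpace ℝ (Fin n)))}
    {F : Set (EuclideanSpace ℝ (Fin n)) → ℝ}

lemma steiner_deriv_nonneg {L0 : Set (EuclideanSpace ℝ (Fin n))} (hL0 : CC L0) (hne : L0.Nonempty)
    {P : Polynomial ℝ} (hP : ∀ ε, 0 ≤ ε → (volume {x | Metric.infDist x L0 ≤ ε}).toReal = P.eval ε)
    {s : ℝ} (hs : 0 < s) : 0 ≤ P.derivative.eval s := by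
  have hmono : MonotoneOn (fun x => P.eval x) (Set.Ici 0) := by
    intro a ha b hb hab
    rw [Set.mem_Ici] at ha hb
    simp only
    rw [← hP a ha, ← hP b hb]
    exact ENNReal.toReal_mono (volume_le_infDist_lt_top hL0.1 hne b).ne
      (measure_mono fun x hx => le_trans hx hab)
  have h := hmono.derivWithin_nonneg (x := s)
  rw [(P.hasDerivAt s).hasDerivWithinAt.derivWithin (uniqueDiffOn_Ici 0 s hs.le)] at h
  exact h

lemma push_measure {L0 : Set (EuclideanSpace ℝ (Fin n))} (hL0 : CC L0) (hne : L0.Nonempty)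
    {P : Polynomial ℝ} (hP : ∀ ε, 0 ≤ ε → (volume {x | Metric.infDist x L0 ≤ ε}).toReal = P.eval ε)
    {α β : ℝ} (hα : 0 < α) :
    (Measure.map (fun y => Metric.infDist y L0) volume).restrict (Set.Ioc α β) =
      (volume.restrict (Set.Ioc α β)).withDensity (fun s => ENNReal.ofReal (P.derivative.eval s)) := by
  have hm : Measurable (fun y => Metric.infDist y L0) := (Metric.continuous_infDist_pt L0).measurable
  have hv : ∀ a b, Measure.map (fun y => Metric.infDist y L0) volume (Set.Ioc a b) =
      volume {y | a < Metric.infDist y L0 ∧ Metric.infDist y L0 ≤ b} := by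
    intro a b
    rw [Measure.map_apply hm measurableSet_Ioc]
    rfl
  have hfin : ∀ a b, volume {y | a < Metric.infDist y L0 ∧ Metric.infDist y L0 ≤ b} < ⊤ := fun a b =>
    (measure_mono fun x hx => hx.2).trans_lt (volume_le_infDist_lt_top hL0.1 hne b)
  have : IsFiniteMeasure ((Measure.map (fun y => Metric.infDist y L0) volume).restrict (Set.Ioc α β)) := by
    constructor
    rw [Measure.restrict_apply_univ, hv]
    exact hfin α β
  refine Measure.ext_of_Ioc _ _ ?_
  intro a b hab
  rw [Measure.restrict_apply measurableSet_Ioc, withDensity_apply _ measurableSet_Ioc,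
    Measure.restrict_restrict measurableSet_Ioc, Set.Ioc_inter_Ioc]
  set a' := max a α with ha'
  set b' := min b β with hb'
  have ha0 : 0 < a' := lt_of_lt_of_le hα (le_max_right _ _)
  change Measure.map (fun y => Metric.infDist y L0) volume (Set.Ioc a' b') =
    ∫⁻ (s : ℝ) in Set.Ioc a' b', ENNReal.ofReal (Polynomial.eval s (Polynomial.derivative P))
  rcases le_total b' a' with h | h
  · rw [Set.Ioc_eq_empty (not_lt.2 h)]; simp
  · rw [hv, ← ENNReal.ofReal_toReal (hfin a' b').ne, shell_vol hL0.1 hne h, hP _ ha0.le, hP _ (ha0.le.trans h)]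
    have hc : Continuous (fun s => P.derivative.eval s) := P.derivative.continuous
    rw [← ofReal_integral_eq_lintegral_ofReal]
    · rw [← intervalIntegral.integral_of_le h,
        intervalIntegral.integral_eq_sub_of_hasDerivAt (f := fun x => P.eval x) (fun x _ => P.hasDerivAt x)
          (hc.intervalIntegrable _ _)]
    · exact (hc.intervalIntegrable a' b').1
    · rw [Filter.EventuallyLE, ae_restrict_iff' measurableSet_Ioc]
      exact Filter.Eventually.of_forall fun s hs => steiner_deriv_nonneg hL0 hne hP (ha0.trans hs.1)

lemma push {L0 : Set (EuclideanSpace ℝ (Fin n))} (hL0 : CC L0) (hne : L0.Nonempty)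
    {P : Polynomial ℝ} (hP : ∀ ε, 0 ≤ ε → (volume {x | Metric.infDist x L0 ≤ ε}).toReal = P.eval ε)
    {α β : ℝ} (hα : 0 < α) (hαβ : α ≤ β) {f : ℝ → ℝ} (hf : Measurable f) (h0 : ∀ s, s ∉ Set.Ioc α β → f s = 0) :
    ∫ y, f (Metric.infDist y L0) = ∫ s in α..β, P.derivative.eval s * f s := by
  have hm : Measurable (fun y => Metric.infDist y L0) := (Metric.continuous_infDist_pt L0).measurable
  rw [← integral_map (φ := fun y => Metric.infDist y L0) (f := f) hm.aemeasurable hf.aestronglyMeasurable,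
    ← setIntegral_eq_integral_of_forall_compl_eq_zero h0, push_measure hL0 hne hP hα,
    integral_withDensity_eq_integral_toReal_smul (f := fun s => ENNReal.ofReal (P.derivative.eval s))
      (ENNReal.measurable_ofReal.comp P.derivative.continuous.measurable)
      (Filter.Eventually.of_forall fun _ => ENNReal.ofReal_lt_top), intervalIntegral.integral_of_le hαβ]
  refine setIntegral_congr_fun measurableSet_Ioc ?_
  intro s hs
  simp only [smul_eq_mul]
  rw [ENNReal.toReal_ofReal (steiner_deriv_nonneg hL0 hne hP (hα.trans hs.1))]

lemma nbhd_formula (hn : 1 ≤ n) (hF : Good G F)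
    (htrans : ∀ x y : EuclideanSpace ℝ (Fin n), ‖x‖ = 1 → ‖y‖ = 1 → ∃ g ∈ G, g x = y)
    {u : EuclideanSpace ℝ (Fin n)} (hu : ‖u‖ = 1)
    {L0 : Set (EuclideanSpace ℝ (Fin n))} (hL0 : CC L0) (hne : L0.Nonempty)
    {P : Polynomial ℝ} (hP : ∀ ε, 0 ≤ ε → (volume {x | Metric.infDist x L0 ≤ ε}).toReal = P.eval ε)
    {ρ : ℝ} (hρ : 0 < ρ) :
    F {x | Metric.infDist x L0 ≤ ρ} * (volume (Metric.closedBall (0 : EuclideanSpace ℝ (Fin n)) 1)).toReal =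
      P.derivative.eval ρ * ∫ t in (-1:ℝ)..1, prof F u t := by
  have h1 := asymp hn hF htrans hu hL0 hne hρ
  have hpm := prof_meas hF hu
  obtain ⟨M, hM⟩ := prof_bdd hF u
  have hM0 : 0 ≤ M := (abs_nonneg _).trans (hM 0)
  have hevr : ∀ᶠ r in nhdsWithin (0:ℝ) (Set.Ioi 0), r < ρ :=
    Filter.Eventually.filter_mono nhdsWithin_le_nhds (Iio_mem_nhds hρ)
  have hev : ∀ᶠ r in nhdsWithin (0:ℝ) (Set.Ioi 0),
      r⁻¹ * ∫ y, prof F u ((ρ - Metric.infDist y L0) / r) =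
        ∫ t in (-1:ℝ)..1, P.derivative.eval (ρ - r * t) * prof F u t := by
    filter_upwards [hevr, self_mem_nhdsWithin] with r hr1 hr
    rw [Set.mem_Ioi] at hr
    rw [push (f := fun s => prof F u ((ρ - s) / r)) (α := ρ - r) (β := ρ + r) hL0 hne hP (by linarith) (by linarith)
      (hpm.comp (by fun_prop))]
    · have h := intervalIntegral.integral_comp_sub_mul (a := -1) (b := 1) (c := r)
        (fun s => P.derivative.eval s * prof F u ((ρ - s) / r)) hr.ne' ρ
      rw [mul_one, mul_neg_one, sub_neg_eq_add, smul_eq_mul] at h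
      rw [← h]
      congr 1
      funext t
      have : (ρ - (ρ - r * t)) / r = t := by field_simp; ring
      rw [this]
    · intro s hs
      apply prof_zero hF hu
      rw [Set.mem_Ioc, not_and_or, not_lt, not_le] at hs
      rcases hs with hs | hs
      · right; rw [le_div_iff₀ hr]; linarith
      · left; rw [div_lt_iff₀ hr]; linarith
  have h2 : Filter.Tendsto (fun r : ℝ => ∫ t in (-1:ℝ)..1, P.derivative.eval (ρ - r * t) * prof F u t)
      (nhdsWithin 0 (Set.Ioi 0)) (nhds (∫ t in (-1:ℝ)..1, P.derivative.eval ρ * prof F u t)) := by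
    obtain ⟨C, hC⟩ := (isCompact_Icc (a := (0:ℝ)) (b := 2 * ρ)).exists_bound_of_continuousOn
      (P.derivative.continuous.continuousOn)
    refine intervalIntegral.tendsto_integral_filter_of_dominated_convergence (fun _ => C * M) ?_ ?_ ?_ ?_
    · refine Filter.Eventually.of_forall fun r => Measurable.aestronglyMeasurable ?_
      exact (P.derivative.continuous.measurable.comp (by fun_prop)).mul hpm
    · filter_upwards [hevr, self_mem_nhdsWithin] with r hr1 hr
      rw [Set.mem_Ioi] at hr
      refine Filter.Eventually.of_forall fun t ht => ?_
      rw [Set.uIoc_of_le (by norm_num)] at ht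
      rw [norm_mul]
      have hb := hC (ρ - r * t) ⟨by nlinarith [ht.1, ht.2], by nlinarith [ht.1, ht.2]⟩
      exact mul_le_mul hb (hM t) (norm_nonneg _) ((norm_nonneg _).trans hb)
    · exact intervalIntegrable_const
    · refine Filter.Eventually.of_forall fun t _ => ?_
      apply Filter.Tendsto.mul_const
      have hc : Continuous (fun r : ℝ => P.derivative.eval (ρ - r * t)) :=
        P.derivative.continuous.comp (by fun_prop)
      have := hc.tendsto 0
      rw [zero_mul, sub_zero] at this
      exact this.mono_left nhdsWithin_le_nhds
  have h3 := tendsto_nhds_unique (h1.congr' hev) h2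
  rw [h3, intervalIntegral.integral_const_mul]

lemma body_formula (hn : 1 ≤ n) (hF : Good G F)
    (htrans : ∀ x y : EuclideanSpace ℝ (Fin n), ‖x‖ = 1 → ‖y‖ = 1 → ∃ g ∈ G, g x = y)
    {u : EuclideanSpace ℝ (Fin n)} (hu : ‖u‖ = 1)
    {L0 : Set (EuclideanSpace ℝ (Fin n))} (hL0 : CC L0) (hne : L0.Nonempty)
    {P : Polynomial ℝ} (hP : ∀ ε, 0 ≤ ε → (volume {x | Metric.infDist x L0 ≤ ε}).toReal = P.eval ε) :
    F L0 * (volume (Metric.closedBall (0 : EuclideanSpace ℝ (Fin n)) 1)).toReal =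
      P.coeff 1 * ∫ t in (-1:ℝ)..1, prof F u t := by
  have h1 : Filter.Tendsto (fun ρ : ℝ => F {x | Metric.infDist x L0 ≤ ρ}) (nhdsWithin 0 (Set.Ioi 0))
      (nhds (F L0)) := by
    obtain ⟨R, hR⟩ := (nbhd_cc hL0 hne zero_le_one).1.isBounded.subset_closedBall 0
    rw [Metric.tendsto_nhds]
    intro ε hε
    obtain ⟨δ, hδ, hun⟩ := hF.unif R ε hε
    have hev : ∀ᶠ r in nhdsWithin (0:ℝ) (Set.Ioi 0), r < min 1 δ :=
      Filter.Eventually.filter_mono nhdsWithin_le_nhds (Iio_mem_nhds (by positivity))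
    filter_upwards [hev, self_mem_nhdsWithin] with ρ hρ1 hρ
    rw [Set.mem_Ioi] at hρ
    have hρ2 : ρ < 1 := hρ1.trans_le (min_le_left _ _)
    have hρ3 : ρ < δ := hρ1.trans_le (min_le_right _ _)
    have hsub : L0 ⊆ {x | Metric.infDist x L0 ≤ ρ} := by
      intro x hx
      rw [Set.mem_ofPred_eq, Metric.infDist_zero_of_mem hx]; exact hρ.le
    have hsub2 : {x | Metric.infDist x L0 ≤ ρ} ⊆ Metric.closedBall 0 R := fun x hx =>
      hR (le_trans hx hρ2.le)
    rw [Real.dist_eq]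
    refine hun _ _ (nbhd_cc hL0 hne hρ.le) hL0 (hne.mono hsub) hne hsub2 (hsub.trans hsub2) ⟨?_, ?_⟩
    · intro x hx
      obtain ⟨y, hy, h⟩ := hL0.1.exists_infDist_eq_dist hne x
      exact ⟨y, hy, by rw [← h]; exact le_trans hx hρ3.le⟩
    · intro x hx
      exact ⟨x, hsub hx, by rw [dist_self]; exact hδ.le⟩
  have h2 : Filter.Tendsto (fun ρ : ℝ => P.derivative.eval ρ * ∫ t in (-1:ℝ)..1, prof F u t)
      (nhdsWithin 0 (Set.Ioi 0)) (nhds (P.coeff 1 * ∫ t in (-1:ℝ)..1, prof F u t)) := by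
    apply Filter.Tendsto.mul_const
    have := (P.derivative.continuous.tendsto 0).mono_left (nhdsWithin_le_nhds (s := Set.Ioi (0:ℝ)))
    rw [← Polynomial.coeff_zero_eq_eval_zero, Polynomial.coeff_derivative] at this
    simpa using this
  refine tendsto_nhds_unique ((h1.mul_const _).congr' ?_) h2
  filter_upwards [self_mem_nhdsWithin] with ρ hρ
  exact nbhd_formula hn hF htrans hu hL0 hne hP hρ

end
end CodimOne

theorem invariant_codim_one_valuation_is_multiple_of_intrinsic (n : ℕ) (hn : 1 ≤ n)
    (G : Subgroup ((EuclideanSpace ℝ (Fin n)) ≃ₗᵢ[ℝ] (EuclideanSpace ℝ (Fin n))))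
    (htrans : ∀ x y : EuclideanSpace ℝ (Fin n), ‖x‖ = 1 → ‖y‖ = 1 →
      ∃ g ∈ G, g x = y)
    (φ : ConvexBody (EuclideanSpace ℝ (Fin n)) → ℝ)
    -- valuation property
    (hval : ∀ K L KL KI : ConvexBody (EuclideanSpace ℝ (Fin n)),
      (KL : Set (EuclideanSpace ℝ (Fin n))) = ↑K ∪ ↑L →
      (KI : Set (EuclideanSpace ℝ (Fin n))) = ↑K ∩ ↑L →
      φ KL = φ K + φ L - φ KI)
    -- translation invariance
    (htransl : ∀ (K K' : ConvexBody (EuclideanSpace ℝ (Fin n)))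
      (x : EuclideanSpace ℝ (Fin n)),
      (K' : Set (EuclideanSpace ℝ (Fin n))) = (fun v => v + x) '' ↑K → φ K' = φ K)
    -- continuity in the Hausdorff metric
    (hcont : Continuous φ)
    -- (n-1)-homogeneity
    (hhom : ∀ (lam : ℝ), 0 ≤ lam → ∀ K, φ (lam • K) = lam ^ (n - 1) * φ K)
    -- G-invariance
    (hG : ∀ g ∈ G, ∀ K K' : ConvexBody (EuclideanSpace ℝ (Fin n)),
      (K' : Set (EuclideanSpace ℝ (Fin n))) = g '' ↑K → φ K' = φ K)
    -- the intrinsic volume V_{n-1} via the Steiner polynomial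
    (Vnm1 : ConvexBody (EuclideanSpace ℝ (Fin n)) → ℝ)
    (hV : ∀ (K : ConvexBody (EuclideanSpace ℝ (Fin n))) (P : Polynomial ℝ),
      (∀ ε : ℝ, 0 ≤ ε →
        (volume ((K : Set (EuclideanSpace ℝ (Fin n)))
          + ε • Metric.closedBall (0 : EuclideanSpace ℝ (Fin n)) 1)).toReal = P.eval ε) →
      Vnm1 K = (1 / 2 : ℝ) * P.coeff 1) :
    ∃ c : ℝ, ∀ K, φ K = c * Vnm1 K := by
  have hF := CodimOne.good_ext G φ hval htransl hcont hhom hG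
  set u : EuclideanSpace ℝ (Fin n) := EuclideanSpace.single ⟨0, hn⟩ 1 with hudef
  have hu : ‖u‖ = 1 := by simp [hudef]
  set κ := (volume (Metric.closedBall (0 : EuclideanSpace ℝ (Fin n)) 1)).toReal with hκ
  have hκ0 : 0 < κ := CodimOne.ball_vol_pos
  refine ⟨2 * (∫ t in (-1:ℝ)..1, CodimOne.prof (CodimOne.ext φ) u t) / κ, fun K => ?_⟩
  obtain ⟨P, hP⟩ := CodimOne.steiner K.isCompact K.convex K.nonempty
  have h1 := CodimOne.body_formula hn hF htrans hu ⟨K.isCompact, K.convex⟩ K.nonempty hP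
  rw [CodimOne.ext_coe, ← hκ] at h1
  have h2 := hV K P (by
    intro ε hε
    rw [← hP ε hε, ← CodimOne.cth_eq K.nonempty hε, smul_closedBall _ _ zero_le_one, smul_zero, mul_one,
      Real.norm_of_nonneg hε, IsCompact.add_closedBall_zero K.isCompact hε])
  rw [h2]
  field_simp
  linarith
end
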